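/- arXiv:1610.02438 — 4 statements merged into one kernel-verified Lean document; each statement's English description precedes it below -/
import Mathlib

section
/- Let C be a category with finite colimits, A an object of C, and σ : A ⊔ A → A ⊔ A a cocartesian Yang–Baxter operator on A which is Wada with trivial torsion. Then the categorical braid closure is invariant under the Markov moves: for all n ≥ 1 and all α, β ∈ B_n one has an isomorphism L(A,σ)[αβα⁻¹] ≅ L(A,σ)[β] in C, and for the standard inclusion ι : B_n → B_{n+1} (sending σ_i to σ_i) one has isomorphisms L(A,σ)[ι(β)·σ_n] ≅ L(A,σ)[β] ≅ L(A,σ)[ι(β)·σ_n⁻¹]. Consequently the isomorphism class of L(A,σ)[β] depends only on the link obtained by closing β. -/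
/-!
STATEMENT 0: For a cocartesian Yang–Baxter operator `σ : A ⊔ A → A ⊔ A` in a
category with finite colimits which is Wada with trivial torsion, the categorical
braid closure `L(A,σ)[β]` (the coequalizer of `id` and the action of `β` on the
`n`-fold coproduct `A^{(n)}`) is invariant under the Markov moves:
`L[αβα⁻¹] ≅ L[β]` and `L[ι(β)·σ_n^{±1}] ≅ L[β]`.
-/

open CategoryTheory CategoryTheory.Limits

universe v u

/-- The braid relations among the generators `σ_1, …, σ_m` (indexed by `Fin m`). -/
def braidRels (m : ℕ) : Set (FreeGroup (Fin m)) :=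
  {r | (∃ i j : Fin m, (i : ℕ) + 1 = (j : ℕ) ∧
          r = FreeGroup.of i * FreeGroup.of j * FreeGroup.of i *
              (FreeGroup.of j * FreeGroup.of i * FreeGroup.of j)⁻¹) ∨
       (∃ i j : Fin m, (i : ℕ) + 2 ≤ (j : ℕ) ∧
          r = FreeGroup.of i * FreeGroup.of j * (FreeGroup.of i)⁻¹ * (FreeGroup.of j)⁻¹)}

/-- The braid group `B_n` on `n` strands. -/
abbrev BraidGroup (n : ℕ) : Type := PresentedGroup (braidRels (n - 1))

/-- The standard generator `σ_i` of `B_n`. -/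
def braidGen {n : ℕ} (i : Fin (n - 1)) : BraidGroup n := PresentedGroup.of i

variable {C : Type u} [Category.{v} C] [HasFiniteColimits C]

/-- The morphism `σ_{i,i+1} = id^{(i-1)} ⊔ σ ⊔ id^{(n-i-1)} : A^{(n)} → A^{(n)}`
induced by `σ : A ⊔ A → A ⊔ A` on the `n`-fold coproduct. -/
noncomputable def sigmaAt (A : C) (σ : A ⨿ A ⟶ A ⨿ A) {n : ℕ} (i : Fin (n - 1)) :
    (∐ fun _ : Fin n => A) ⟶ (∐ fun _ : Fin n => A) :=
  Sigma.desc fun j =>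
    if j = (⟨i.1, by have := i.isLt; omega⟩ : Fin n) then
      coprod.inl ≫ σ ≫
        coprod.desc (Sigma.ι (fun _ : Fin n => A) ⟨i.1, by have := i.isLt; omega⟩)
          (Sigma.ι (fun _ : Fin n => A) ⟨i.1 + 1, by have := i.isLt; omega⟩)
    else if j = (⟨i.1 + 1, by have := i.isLt; omega⟩ : Fin n) then
      coprod.inr ≫ σ ≫
        coprod.desc (Sigma.ι (fun _ : Fin n => A) ⟨i.1, by have := i.isLt; omega⟩)
          (Sigma.ι (fun _ : Fin n => A) ⟨i.1 + 1, by have := i.isLt; omega⟩)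
    else Sigma.ι (fun _ : Fin n => A) j

/-- The coequalizer `E` of `i₂` and `σ∘i₂ : A → A ⊔ A`. -/
noncomputable def wadaObj (A : C) (σ : A ⨿ A ⟶ A ⨿ A) : C :=
  coequalizer (coprod.inr : A ⟶ A ⨿ A) ((coprod.inr : A ⟶ A ⨿ A) ≫ σ)

/-- The morphism `j' = p ∘ i₁ : A → E`;  `σ` is Wada iff this is an isomorphism. -/
noncomputable def wadaJ (A : C) (σ : A ⨿ A ⟶ A ⨿ A) : A ⟶ wadaObj A σ :=
  coprod.inl ≫ coequalizer.π (coprod.inr : A ⟶ A ⨿ A) ((coprod.inr : A ⟶ A ⨿ A) ≫ σ)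

section Wada

variable {A : C} {σ : A ⨿ A ⟶ A ⨿ A}

/-- The quotient map onto the Wada object. -/
noncomputable def wadaπ (A : C) (σ : A ⨿ A ⟶ A ⨿ A) : A ⨿ A ⟶ wadaObj A σ :=
  coequalizer.π (coprod.inr : A ⟶ A ⨿ A) ((coprod.inr : A ⟶ A ⨿ A) ≫ σ)

/-- The morphism `A ⟶ A` expressing the second strand of the Wada quotient through the first. -/
noncomputable def wadaTau (A : C) (σ : A ⨿ A ⟶ A ⨿ A) [IsIso (wadaJ A σ)] : A ⟶ A :=
  coprod.inr ≫ wadaπ A σ ≫ inv (wadaJ A σ)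

/-- The Wada quotient map, with its target identified with `A`. -/
noncomputable def wadaFold (A : C) (σ : A ⨿ A ⟶ A ⨿ A) [IsIso (wadaJ A σ)] : A ⨿ A ⟶ A :=
  coprod.desc (𝟙 A) (wadaTau A σ)

theorem wadaFold_eq [IsIso (wadaJ A σ)] : wadaFold A σ = wadaπ A σ ≫ inv (wadaJ A σ) := by
  ext
  · rw [wadaFold, coprod.inl_desc, ← Category.assoc]
    exact (IsIso.hom_inv_id (wadaJ A σ)).symm
  · rw [wadaFold, coprod.inr_desc, wadaTau]

theorem comp_wadaFold [IsIso (wadaJ A σ)]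
    (hT : coprod.inl ≫ σ ≫
        coequalizer.π (coprod.inr : A ⟶ A ⨿ A) ((coprod.inr : A ⟶ A ⨿ A) ≫ σ) = wadaJ A σ) :
    σ ≫ wadaFold A σ = wadaFold A σ := by
  have h : σ ≫ wadaπ A σ = wadaπ A σ := by
    ext
    · exact hT
    · rw [← Category.assoc]
      exact (coequalizer.condition _ _).symm
  rw [wadaFold_eq, ← Category.assoc, h]

theorem wadaFold_fac [IsIso (wadaJ A σ)] {Y : C} (u : A ⨿ A ⟶ Y)
    (hu : coprod.inr ≫ σ ≫ u = coprod.inr ≫ u) :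
    wadaFold A σ ≫ coprod.inl ≫ u = u := by
  have h : coprod.inr ≫ u = (coprod.inr ≫ σ) ≫ u := by rw [Category.assoc, hu]
  let d : wadaObj A σ ⟶ Y := coequalizer.desc u h
  have hd : wadaπ A σ ≫ d = u := coequalizer.π_desc u h
  have hJ : wadaJ A σ = coprod.inl ≫ wadaπ A σ := rfl
  rw [← hd, ← Category.assoc coprod.inl, ← hJ, wadaFold_eq, Category.assoc,
    IsIso.inv_hom_id_assoc]

end Wada

section Strands

variable (A : C)

/-- The inclusion of the first `n` strands into `n + 1` strands. -/
noncomputable def strandIncl (n : ℕ) :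
    (∐ fun _ : Fin n => A) ⟶ (∐ fun _ : Fin (n + 1) => A) :=
  Sigma.desc fun j => Sigma.ι (fun _ : Fin (n + 1) => A) j.castSucc

/-- The inclusion of the last strand. -/
noncomputable def lastStrand (n : ℕ) : A ⟶ (∐ fun _ : Fin (n + 1) => A) :=
  Sigma.ι (fun _ : Fin (n + 1) => A) (Fin.last n)

variable {A}

theorem strand_hom_ext {n : ℕ} {Y : C} {f g : (∐ fun _ : Fin (n + 1) => A) ⟶ Y}
    (h : strandIncl A n ≫ f = strandIncl A n ≫ g)
    (hl : lastStrand A n ≫ f = lastStrand A n ≫ g) : f = g := by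
  refine Sigma.hom_ext _ _ fun j => ?_
  induction j using Fin.lastCases with
  | last => exact hl
  | cast j => simpa [strandIncl] using congrArg (Sigma.ι (fun _ : Fin n => A) j ≫ ·) h

variable {σ : A ⨿ A ⟶ A ⨿ A}

theorem sigmaAt_comp_strandIncl {n : ℕ} (i : Fin (n - 1)) :
    sigmaAt A σ i ≫ strandIncl A n = strandIncl A n ≫
      sigmaAt A σ (⟨i.1, by have := i.isLt; omega⟩ : Fin ((n + 1) - 1)) := by
  refine Sigma.hom_ext _ _ fun j => ?_
  simp only [sigmaAt, strandIncl, colimit.ι_desc_assoc, colimit.ι_desc, Cofan.mk_ι_app,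
    Discrete.functor_obj_eq_as, Fin.ext_iff, Fin.val_castSucc]
  split_ifs
  all_goals simp

theorem lastStrand_comp_sigmaAt {n : ℕ} (i : Fin (n - 1)) :
    lastStrand A n ≫ sigmaAt A σ (⟨i.1, by have := i.isLt; omega⟩ : Fin ((n + 1) - 1)) =
      lastStrand A n := by
  have := i.isLt
  have h₁ : ¬ n = i.1 := by omega
  have h₂ : ¬ n = i.1 + 1 := by omega
  simp [sigmaAt, lastStrand, Fin.ext_iff, h₁, h₂]

variable (A) in
/-- The inclusion of the last two strands. -/
noncomputable def lastPair (m : ℕ) : A ⨿ A ⟶ (∐ fun _ : Fin (m + 1 + 1) => A) :=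
  coprod.desc (Sigma.ι (fun _ : Fin (m + 1 + 1) => A) (Fin.last m).castSucc)
    (lastStrand A (m + 1))

theorem lastPair_comp_sigmaAt (m : ℕ) (h : m < m + 1 + 1 - 1) :
    lastPair A m ≫ sigmaAt A σ (n := m + 1 + 1) ⟨m, h⟩ = σ ≫ lastPair A m := by
  ext
  · simp [lastPair, sigmaAt, lastStrand, Fin.ext_iff, coprod.inl_desc]
    rfl
  · simp [lastPair, sigmaAt, lastStrand, Fin.ext_iff, coprod.inr_desc]
    rfl

theorem ι_comp_sigmaAt_last (m : ℕ) (h : m < m + 1 + 1 - 1) (j : Fin m) :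
    Sigma.ι (fun _ : Fin (m + 1 + 1) => A) j.castSucc.castSucc ≫
      sigmaAt A σ (n := m + 1 + 1) ⟨m, h⟩ =
    Sigma.ι (fun _ : Fin (m + 1 + 1) => A) j.castSucc.castSucc := by
  have := j.isLt
  have h₁ : ¬ j.1 = m := by omega
  have h₂ : ¬ j.1 = m + 1 := by omega
  simp [sigmaAt, Fin.ext_iff, h₁, h₂]

variable (A σ) in
/-- The retraction of `m + 2` strands onto `m + 1` strands which folds the last pair. -/
noncomputable def strandRetr [IsIso (wadaJ A σ)] (m : ℕ) :
    (∐ fun _ : Fin (m + 1 + 1) => A) ⟶ (∐ fun _ : Fin (m + 1) => A) :=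
  Sigma.desc (Fin.lastCases (wadaTau A σ ≫ Sigma.ι (fun _ : Fin (m + 1) => A) (Fin.last m))
    fun j => Sigma.ι (fun _ : Fin (m + 1) => A) j)

variable [IsIso (wadaJ A σ)]

theorem ι_castSucc_comp_strandRetr {m : ℕ} (j : Fin (m + 1)) :
    Sigma.ι (fun _ : Fin (m + 1 + 1) => A) j.castSucc ≫ strandRetr A σ m =
      Sigma.ι (fun _ : Fin (m + 1) => A) j := by
  simp [strandRetr]

theorem lastStrand_comp_strandRetr (m : ℕ) :
    lastStrand A (m + 1) ≫ strandRetr A σ m =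
      wadaTau A σ ≫ Sigma.ι (fun _ : Fin (m + 1) => A) (Fin.last m) := by
  simp [strandRetr, lastStrand]

theorem strandIncl_comp_strandRetr (m : ℕ) :
    strandIncl A (m + 1) ≫ strandRetr A σ m = 𝟙 _ := by
  refine Sigma.hom_ext _ _ fun j => ?_
  simp [strandIncl, ι_castSucc_comp_strandRetr]

theorem lastPair_comp_strandRetr (m : ℕ) :
    lastPair A m ≫ strandRetr A σ m =
      wadaFold A σ ≫ Sigma.ι (fun _ : Fin (m + 1) => A) (Fin.last m) := by
  ext
  · simp [lastPair, wadaFold, coprod.inl_desc, ι_castSucc_comp_strandRetr]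
  · simp [lastPair, wadaFold, coprod.inr_desc, lastStrand_comp_strandRetr]

theorem lastPair_hom_ext {m : ℕ} {Y : C} {f g : (∐ fun _ : Fin (m + 1 + 1) => A) ⟶ Y}
    (h : ∀ j : Fin m, Sigma.ι (fun _ : Fin (m + 1 + 1) => A) j.castSucc.castSucc ≫ f =
      Sigma.ι (fun _ : Fin (m + 1 + 1) => A) j.castSucc.castSucc ≫ g)
    (hl : lastPair A m ≫ f = lastPair A m ≫ g) : f = g := by
  refine Sigma.hom_ext _ _ fun j => ?_
  induction j using Fin.lastCases with
  | last => simpa [lastPair, lastStrand, coprod.inr_desc] using congrArg (coprod.inr ≫ ·) hl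
  | cast j =>
    induction j using Fin.lastCases with
    | last => simpa [lastPair, coprod.inl_desc] using congrArg (coprod.inl ≫ ·) hl
    | cast j => exact h j

theorem sigmaAt_comp_strandRetr
    (hT : coprod.inl ≫ σ ≫
        coequalizer.π (coprod.inr : A ⟶ A ⨿ A) ((coprod.inr : A ⟶ A ⨿ A) ≫ σ) = wadaJ A σ)
    (m : ℕ) (h : m < m + 1 + 1 - 1) :
    sigmaAt A σ (n := m + 1 + 1) ⟨m, h⟩ ≫ strandRetr A σ m = strandRetr A σ m := by
  refine lastPair_hom_ext (fun j => ?_) ?_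
  · rw [← Category.assoc, ι_comp_sigmaAt_last]
  · rw [← Category.assoc, lastPair_comp_sigmaAt, Category.assoc, lastPair_comp_strandRetr,
      ← Category.assoc, comp_wadaFold hT]

/-- A morphism whose last strand is preserved by the last generator factors through the
retraction onto the first `m + 1` strands. -/
theorem strandRetr_fac {m : ℕ} (h : m < m + 1 + 1 - 1) {Y : C}
    (k : (∐ fun _ : Fin (m + 1 + 1) => A) ⟶ Y)
    (hk : lastStrand A (m + 1) ≫ sigmaAt A σ (n := m + 1 + 1) ⟨m, h⟩ ≫ k =
      lastStrand A (m + 1) ≫ k) :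
    strandRetr A σ m ≫ strandIncl A (m + 1) ≫ k = k := by
  refine lastPair_hom_ext (fun j => ?_) ?_
  · rw [← Category.assoc, ι_castSucc_comp_strandRetr]
    simp [strandIncl]
  · have hr : (coprod.inr : A ⟶ A ⨿ A) ≫ lastPair A m = lastStrand A (m + 1) := by
      simp [lastPair, coprod.inr_desc]
    have hl : (coprod.inl : A ⟶ A ⨿ A) ≫ lastPair A m =
        Sigma.ι (fun _ : Fin (m + 1) => A) (Fin.last m) ≫ strandIncl A (m + 1) := by
      simp [lastPair, strandIncl, coprod.inl_desc]
    have hu : coprod.inr ≫ σ ≫ lastPair A m ≫ k = coprod.inr ≫ lastPair A m ≫ k := by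
      rw [← hr, Category.assoc, Category.assoc] at hk
      rwa [← Category.assoc σ, ← lastPair_comp_sigmaAt m h, Category.assoc]
    rw [← Category.assoc, lastPair_comp_strandRetr, Category.assoc, ← Category.assoc (Sigma.ι _ _),
      ← hl, Category.assoc]
    exact wadaFold_fac _ hu

end Strands

section Coequalizer

variable {D : Type u} [Category.{v} D] [HasCoequalizers D]

theorem nonempty_coequalizer_conj_iso {X : D} (a : X ≅ X) (b : X ⟶ X) :
    Nonempty (coequalizer (𝟙 X) (a.inv ≫ b ≫ a.hom) ≅ coequalizer (𝟙 X) b) := by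
  have h₁ := coequalizer.condition (𝟙 X) b
  have h₂ := coequalizer.condition (𝟙 X) (a.inv ≫ b ≫ a.hom)
  simp only [Category.id_comp, Category.assoc] at h₁ h₂
  refine ⟨⟨coequalizer.desc (a.inv ≫ coequalizer.π _ _) ?_,
    coequalizer.desc (a.hom ≫ coequalizer.π _ _) ?_, ?_, ?_⟩⟩
  · simp only [Category.id_comp, Category.assoc, Iso.hom_inv_id_assoc, ← h₁]
  · rw [Category.id_comp, ← Iso.eq_inv_comp, ← h₂]
  · ext; simp
  · ext; simp

theorem nonempty_coequalizer_iso_of_retract {X Y : D} (f : X ⟶ X) (g : Y ⟶ Y)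
    (i : X ⟶ Y) (r : Y ⟶ X) (hir : i ≫ r = 𝟙 X)
    (hg : g ≫ r ≫ coequalizer.π (𝟙 X) f = r ≫ coequalizer.π (𝟙 X) f)
    (hf : f ≫ i ≫ coequalizer.π (𝟙 Y) g = i ≫ coequalizer.π (𝟙 Y) g)
    (hri : r ≫ i ≫ coequalizer.π (𝟙 Y) g = coequalizer.π (𝟙 Y) g) :
    Nonempty (coequalizer (𝟙 Y) g ≅ coequalizer (𝟙 X) f) := by
  refine ⟨⟨coequalizer.desc (r ≫ coequalizer.π _ _) (by rw [Category.id_comp, hg]),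
    coequalizer.desc (i ≫ coequalizer.π _ _) (by rw [Category.id_comp, hf]), ?_, ?_⟩⟩
  · ext; simp [hri]
  · ext; simp [reassoc_of% hir]

end Coequalizer

theorem braid_induction {n : ℕ} {p : BraidGroup n → Prop} (one : p 1)
    (gen : ∀ i, p (braidGen i)) (mul : ∀ a b, p a → p b → p (a * b))
    (inv : ∀ a, p a → p a⁻¹) (β : BraidGroup n) : p β := by
  have h : β ∈ Subgroup.closure (Set.range (PresentedGroup.of (rels := braidRels (n - 1)))) := by
    rw [PresentedGroup.closure_range_of]
    trivial
  induction h using Subgroup.closure_induction with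
  | mem x hx => obtain ⟨i, rfl⟩ := hx; exact gen i
  | one => exact one
  | mul x y _ _ hx hy => exact mul x y hx hy
  | inv x _ hx => exact inv x hx

section Inclusion

variable {A : C} {σ : A ⨿ A ⟶ A ⨿ A} {n : ℕ}
  {ψ : BraidGroup n →* Aut (∐ fun _ : Fin n => A)}
  {ψ' : BraidGroup n →* Aut (∐ fun _ : Fin (n + 1) => A)}

theorem strandIncl_comp_braid (hψ : ∀ i, (ψ (braidGen i)).hom = sigmaAt A σ i)
    (hψ' : ∀ i : Fin (n - 1), (ψ' (braidGen i)).hom =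
      sigmaAt A σ (⟨i.1, by have := i.isLt; omega⟩ : Fin ((n + 1) - 1))) (β : BraidGroup n) :
    strandIncl A n ≫ (ψ' β).hom = (ψ β).hom ≫ strandIncl A n := by
  induction β using braid_induction with
  | one =>
    rw [map_one, map_one]
    exact (Category.comp_id _).trans (Category.id_comp _).symm
  | gen i => rw [hψ, hψ', sigmaAt_comp_strandIncl]
  | mul a b ha hb =>
    rw [map_mul, map_mul]
    change _ ≫ (ψ' b).hom ≫ (ψ' a).hom = ((ψ b).hom ≫ (ψ a).hom) ≫ _
    rw [reassoc_of% hb, ha, Category.assoc]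
  | inv a ha =>
    rw [map_inv, map_inv]
    exact (Iso.comp_inv_eq _).2 (((Iso.inv_comp_eq _).2 ha).symm.trans
      (Category.assoc _ _ _).symm)

theorem lastStrand_comp_braid
    (hψ' : ∀ i : Fin (n - 1), (ψ' (braidGen i)).hom =
      sigmaAt A σ (⟨i.1, by have := i.isLt; omega⟩ : Fin ((n + 1) - 1))) (β : BraidGroup n) :
    lastStrand A n ≫ (ψ' β).hom = lastStrand A n := by
  induction β using braid_induction with
  | one =>
    rw [map_one]
    exact Category.comp_id _
  | gen i => rw [hψ', lastStrand_comp_sigmaAt]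
  | mul a b ha hb =>
    rw [map_mul]
    change _ ≫ (ψ' b).hom ≫ (ψ' a).hom = _
    rw [reassoc_of% hb, ha]
  | inv a ha =>
    rw [map_inv]
    exact (Iso.comp_inv_eq _).2 ha.symm

end Inclusion

section Stabilization

variable {A : C} {σ : A ⨿ A ⟶ A ⨿ A} [IsIso (wadaJ A σ)] {m : ℕ}
  {f : (∐ fun _ : Fin (m + 1) => A) ⟶ (∐ fun _ : Fin (m + 1) => A)}
  {b : (∐ fun _ : Fin (m + 1 + 1) => A) ⟶ (∐ fun _ : Fin (m + 1 + 1) => A)}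
  {s : (∐ fun _ : Fin (m + 1 + 1) => A) ≅ (∐ fun _ : Fin (m + 1 + 1) => A)}

theorem nonempty_stabilization_iso
    (hT : coprod.inl ≫ σ ≫
        coequalizer.π (coprod.inr : A ⟶ A ⨿ A) ((coprod.inr : A ⟶ A ⨿ A) ≫ σ) = wadaJ A σ)
    (h : m < m + 1 + 1 - 1) (hs : s.hom = sigmaAt A σ (n := m + 1 + 1) ⟨m, h⟩)
    (hb : strandIncl A (m + 1) ≫ b = f ≫ strandIncl A (m + 1))
    (hbl : lastStrand A (m + 1) ≫ b = lastStrand A (m + 1)) :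
    Nonempty (coequalizer (𝟙 _) (s.hom ≫ b) ≅ coequalizer (𝟙 _) f) ∧
      Nonempty (coequalizer (𝟙 _) (s.inv ≫ b) ≅ coequalizer (𝟙 _) f) := by
  have hsr : s.hom ≫ strandRetr A σ m = strandRetr A σ m := by
    rw [hs, sigmaAt_comp_strandRetr hT]
  have hsr' : s.inv ≫ strandRetr A σ m = strandRetr A σ m := by
    rw [Iso.inv_comp_eq, hsr]
  have hfac {Y : C} (k : (∐ fun _ : Fin (m + 1 + 1) => A) ⟶ Y)
      (hk : lastStrand A (m + 1) ≫ s.hom ≫ k = lastStrand A (m + 1) ≫ k) :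
      strandRetr A σ m ≫ strandIncl A (m + 1) ≫ k = k ∧ s.hom ≫ k = k := by
    have hr := strandRetr_fac (σ := σ) h k (by rwa [← hs])
    exact ⟨hr, by rw [← hr, reassoc_of% hsr]⟩
  have hf : f ≫ coequalizer.π (𝟙 _) f = coequalizer.π (𝟙 _) f := by
    rw [← coequalizer.condition, Category.id_comp]
  have hbr : b ≫ strandRetr A σ m ≫ coequalizer.π (𝟙 _) f =
      strandRetr A σ m ≫ coequalizer.π (𝟙 _) f := by
    refine strand_hom_ext ?_ ?_
    · rw [reassoc_of% hb, reassoc_of% strandIncl_comp_strandRetr (A := A) (σ := σ) m, hf]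
    · rw [reassoc_of% hbl]
  constructor
  · have hπ : s.hom ≫ b ≫ coequalizer.π (𝟙 _) (s.hom ≫ b) =
        coequalizer.π (𝟙 _) (s.hom ≫ b) := by
      simpa using (coequalizer.condition (𝟙 _) (s.hom ≫ b)).symm
    obtain ⟨hr, hk⟩ := hfac (b ≫ coequalizer.π (𝟙 _) (s.hom ≫ b))
      (by rw [hπ, reassoc_of% hbl])
    rw [hπ] at hk
    rw [← hk] at hr
    refine nonempty_coequalizer_iso_of_retract f _ (strandIncl A (m + 1)) (strandRetr A σ m)
      (strandIncl_comp_strandRetr m) ?_ ?_ hr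
    · rw [Category.assoc, hbr, reassoc_of% hsr]
    · rw [← reassoc_of% hb, ← hk]
  · have hπ : b ≫ coequalizer.π (𝟙 _) (s.inv ≫ b) =
        s.hom ≫ coequalizer.π (𝟙 _) (s.inv ≫ b) := by
      rw [← Iso.inv_comp_eq]
      simpa using
        (coequalizer.condition (𝟙 _) (s.inv ≫ b)).symm
    obtain ⟨hr, hk⟩ := hfac (coequalizer.π (𝟙 _) (s.inv ≫ b))
      (by rw [← hπ, reassoc_of% hbl])
    refine nonempty_coequalizer_iso_of_retract f _ (strandIncl A (m + 1)) (strandRetr A σ m)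
      (strandIncl_comp_strandRetr m) ?_ ?_ hr
    · rw [Category.assoc, hbr, reassoc_of% hsr']
    · rw [← reassoc_of% hb, hπ, hk]

end Stabilization

theorem statement0 (A : C) (σ : A ⨿ A ⟶ A ⨿ A)
    -- σ is a cocartesian Yang-Baxter operator: invertible and satisfying
    -- σ₂₃σ₁₂σ₂₃ = σ₁₂σ₂₃σ₁₂ on the threefold coproduct
    (hinv : IsIso σ)
    (hYB : sigmaAt A σ (n := 3) 1 ≫ sigmaAt A σ (n := 3) 0 ≫ sigmaAt A σ (n := 3) 1 =
           sigmaAt A σ (n := 3) 0 ≫ sigmaAt A σ (n := 3) 1 ≫ sigmaAt A σ (n := 3) 0)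
    -- σ is Wada with trivial torsion
    (hW : IsIso (wadaJ A σ))
    (hT : coprod.inl ≫ σ ≫
        coequalizer.π (coprod.inr : A ⟶ A ⨿ A) ((coprod.inr : A ⟶ A ⨿ A) ≫ σ) =
      wadaJ A σ)
    -- the braid group actions generated by σ: σ_i acts as σ_{i,i+1}
    (φ : ∀ m : ℕ, BraidGroup m →* Aut (∐ fun _ : Fin m => A))
    (hφ : ∀ (m : ℕ) (i : Fin (m - 1)), (φ m (braidGen i)).hom = sigmaAt A σ i)
    (n : ℕ) (hn : 1 ≤ n)
    -- the standard inclusion ι : B_n → B_{n+1}, σ_i ↦ σ_i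
    (ι : BraidGroup n →* BraidGroup (n + 1))
    (hι : ∀ i : Fin (n - 1),
      ι (braidGen i) = braidGen (⟨i.1, by have := i.isLt; omega⟩ : Fin ((n + 1) - 1)))
    (α β : BraidGroup n) :
    -- Markov move I (conjugation)
    Nonempty (coequalizer (𝟙 (∐ fun _ : Fin n => A)) ((φ n (α * β * α⁻¹)).hom) ≅
      coequalizer (𝟙 (∐ fun _ : Fin n => A)) ((φ n β).hom)) ∧
    -- Markov move II (positive stabilization)
    Nonempty (coequalizer (𝟙 (∐ fun _ : Fin (n + 1) => A))
        ((φ (n + 1) (ι β * braidGen (⟨n - 1, by omega⟩ : Fin ((n + 1) - 1)))).hom) ≅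
      coequalizer (𝟙 (∐ fun _ : Fin n => A)) ((φ n β).hom)) ∧
    -- Markov move II (negative stabilization)
    Nonempty (coequalizer (𝟙 (∐ fun _ : Fin (n + 1) => A))
        ((φ (n + 1) (ι β * (braidGen (⟨n - 1, by omega⟩ : Fin ((n + 1) - 1)))⁻¹)).hom) ≅
      coequalizer (𝟙 (∐ fun _ : Fin n => A)) ((φ n β).hom)) := by
  obtain ⟨m, rfl⟩ : ∃ m, n = m + 1 := ⟨n - 1, by omega⟩
  have hψ' (i : Fin (m + 1 - 1)) : (((φ (m + 1 + 1)).comp ι) (braidGen i)).hom =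
      sigmaAt A σ (⟨i.1, by have := i.isLt; omega⟩ : Fin ((m + 1 + 1) - 1)) := by
    rw [MonoidHom.comp_apply, hι, hφ]
  refine ⟨?_, ?_⟩
  · rw [map_mul, map_mul, map_inv]
    exact nonempty_coequalizer_conj_iso (φ (m + 1) α) (φ (m + 1) β).hom
  · rw [map_mul, map_mul, map_inv]
    exact nonempty_stabilization_iso (s := φ (m + 1 + 1) (braidGen _)) hT (by omega) (hφ _ _)
      (strandIncl_comp_braid (hφ (m + 1)) hψ' β) (lastStrand_comp_braid hψ' β)
end

section
/- For every n ≥ 1, the Gelfand–MacPherson–Vilonen assignments define a left action of the braid group B_n on the k-linear category Ã^{(n)} by k-linear automorphisms: for each 1 ≤ i ≤ n−1 there is a well-defined invertible k-linear functor σ_i : Ã^{(n)} → Ã^{(n)} which swaps the objects i and i+1, fixes the other objects, and sends a_i ↦ T_i a_{i+1}, a_{i+1} ↦ a_i, a_i^* ↦ a_{i+1}^* T_i^{-1}, a_{i+1}^* ↦ a_i^*, and a_j ↦ a_j, a_j^* ↦ a_j^* for j ≠ i, i+1; and these functors satisfy the braid relations σ_iσ_{i+1}σ_i = σ_{i+1}σ_iσ_{i+1}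 and σ_iσ_j = σ_jσ_i for |i−j| ≥ 2. Equivalently, the functor σ : Ã^{(2)} → Ã^{(2)} given by a₁ ↦ T₁a₂, a₁^* ↦ a₂^*T₁^{-1}, a₂ ↦ a₁, a₂^* ↦ a₁^* (swapping objects 1 and 2) is a cocartesian Yang–Baxter operator on the pointed k-category Ã. -/
/-- Generators of the `k`-category `Ã^{(n)}` (encoded as a `k`-algebra with
idempotents `e_i` corresponding to the objects `{0, 1, …, n}`): the identities
`e_i`, the arrows `a_i : i → 0` and `a_i^* : 0 → i`, and the formal inverses
`t_i` of the endomorphisms `T_i = e₀ + a_i a_i^*` of the object `0`. -/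
inductive TGen (n : ℕ) : Type
  | e : Fin (n + 1) → TGen n
  | a : Fin n → TGen n
  | as : Fin n → TGen n
  | t : Fin n → TGen n

variable (k : Type) [CommRing k]

/-- The defining relations of `Ã^{(n)}`: the `e_i` are orthogonal idempotents
summing to `1` (encoding the objects), the arrows are placed in the correct
hom-components (`a_i = e₀ a_i e_i` etc., where object `i ∈ {1,…,n}` is encoded as
`(i : Fin n).succ`), and `t_i` is a two-sided inverse of `T_i = e₀ + a_i a_i^*`
in the endomorphism algebra of the object `0`. -/
inductive TRel (n : ℕ) : FreeAlgebra k (TGen n) → FreeAlgebra k (TGen n) → Prop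
  | idem (i : Fin (n + 1)) :
      TRel n (FreeAlgebra.ι k (TGen.e i) * FreeAlgebra.ι k (TGen.e i)) (FreeAlgebra.ι k (TGen.e i))
  | orth (i j : Fin (n + 1)) (h : i ≠ j) :
      TRel n (FreeAlgebra.ι k (TGen.e i) * FreeAlgebra.ι k (TGen.e j)) 0
  | esum : TRel n (∑ i : Fin (n + 1), FreeAlgebra.ι k (TGen.e i)) 1
  | aL (i : Fin n) :
      TRel n (FreeAlgebra.ι k (TGen.e 0) * FreeAlgebra.ι k (TGen.a i)) (FreeAlgebra.ι k (TGen.a i))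
  | aR (i : Fin n) :
      TRel n (FreeAlgebra.ι k (TGen.a i) * FreeAlgebra.ι k (TGen.e i.succ)) (FreeAlgebra.ι k (TGen.a i))
  | asL (i : Fin n) :
      TRel n (FreeAlgebra.ι k (TGen.e i.succ) * FreeAlgebra.ι k (TGen.as i)) (FreeAlgebra.ι k (TGen.as i))
  | asR (i : Fin n) :
      TRel n (FreeAlgebra.ι k (TGen.as i) * FreeAlgebra.ι k (TGen.e 0)) (FreeAlgebra.ι k (TGen.as i))
  | tL (i : Fin n) :
      TRel n (FreeAlgebra.ι k (TGen.e 0) * FreeAlgebra.ι k (TGen.t i)) (FreeAlgebra.ι k (TGen.t i))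
  | tR (i : Fin n) :
      TRel n (FreeAlgebra.ι k (TGen.t i) * FreeAlgebra.ι k (TGen.e 0)) (FreeAlgebra.ι k (TGen.t i))
  | tinvR (i : Fin n) :
      TRel n ((FreeAlgebra.ι k (TGen.e 0) + FreeAlgebra.ι k (TGen.a i) * FreeAlgebra.ι k (TGen.as i)) *
        FreeAlgebra.ι k (TGen.t i)) (FreeAlgebra.ι k (TGen.e 0))
  | tinvL (i : Fin n) :
      TRel n (FreeAlgebra.ι k (TGen.t i) *
        (FreeAlgebra.ι k (TGen.e 0) + FreeAlgebra.ι k (TGen.a i) * FreeAlgebra.ι k (TGen.as i)))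
        (FreeAlgebra.ι k (TGen.e 0))

/-- The `k`-category `Ã^{(n)}` (the localized path category), encoded as a
`k`-algebra with idempotents: the `n`-fold fusion coproduct of copies of `Ã`. -/
abbrev TAlg (n : ℕ) : Type := RingQuot (TRel k n)

/-- The idempotent `e_i` corresponding to the object `i ∈ {0, 1, …, n}`. -/
noncomputable def eT (n : ℕ) (i : Fin (n + 1)) : TAlg k n :=
  RingQuot.mkAlgHom k (TRel k n) (FreeAlgebra.ι k (TGen.e i))

/-- The generating morphism `a_i : i → 0`. -/
noncomputable def aT (n : ℕ) (i : Fin n) : TAlg k n :=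
  RingQuot.mkAlgHom k (TRel k n) (FreeAlgebra.ι k (TGen.a i))

/-- The generating morphism `a_i^* : 0 → i`. -/
noncomputable def asT (n : ℕ) (i : Fin n) : TAlg k n :=
  RingQuot.mkAlgHom k (TRel k n) (FreeAlgebra.ι k (TGen.as i))

/-- The inverse `T_i^{-1}` of `T_i`. -/
noncomputable def tinvT (n : ℕ) (i : Fin n) : TAlg k n :=
  RingQuot.mkAlgHom k (TRel k n) (FreeAlgebra.ι k (TGen.t i))

/-- The invertible endomorphism `T_i = e₀ + a_i a_i^*` of the object `0`. -/
noncomputable def TT (n : ℕ) (i : Fin n) : TAlg k n :=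
  eT k n 0 + aT k n i * asT k n i

/-- The strand `i` (as an index in `Fin n`). -/
def lo {n : ℕ} (i : Fin (n - 1)) : Fin n := ⟨i.1, by have := i.isLt; omega⟩
/-- The strand `i+1` (as an index in `Fin n`). -/
def hi {n : ℕ} (i : Fin (n - 1)) : Fin n := ⟨i.1 + 1, by have := i.isLt; omega⟩

/-- The Gelfand–MacPherson–Vilonen assignments for the generator `σ_i` acting on
`Ã^{(n)}`: it swaps the objects `i` and `i+1`, fixes the other objects, and sends
`a_i ↦ T_i a_{i+1}`, `a_{i+1} ↦ a_i`, `a_i^* ↦ a_{i+1}^* T_i^{-1}`,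
`a_{i+1}^* ↦ a_i^*`, fixing `a_j, a_j^*` for `j ≠ i, i+1`. -/
def IsGMVAt (n : ℕ) (i : Fin (n - 1)) (σ : TAlg k n → TAlg k n) : Prop :=
  σ (eT k n 0) = eT k n 0 ∧
  σ (eT k n (lo i).succ) = eT k n (hi i).succ ∧
  σ (eT k n (hi i).succ) = eT k n (lo i).succ ∧
  (∀ j : Fin n, j ≠ lo i → j ≠ hi i → σ (eT k n j.succ) = eT k n j.succ) ∧
  σ (aT k n (lo i)) = TT k n (lo i) * aT k n (hi i) ∧
  σ (aT k n (hi i)) = aT k n (lo i) ∧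
  σ (asT k n (lo i)) = asT k n (hi i) * tinvT k n (lo i) ∧
  σ (asT k n (hi i)) = asT k n (lo i) ∧
  (∀ j : Fin n, j ≠ lo i → j ≠ hi i →
    σ (aT k n j) = aT k n j ∧ σ (asT k n j) = asT k n j)

section Relations

variable {k} {n : ℕ}

lemma eT_mul_self (i : Fin (n + 1)) : eT k n i * eT k n i = eT k n i := by
  simpa only [eT, aT, asT, tinvT, TT, map_mul] using RingQuot.mkAlgHom_rel k (TRel.idem (k := k) i)

lemma eT_mul_of_ne {i j : Fin (n + 1)} (h : i ≠ j) : eT k n i * eT k n j = 0 := by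
  simpa only [eT, aT, asT, tinvT, TT, map_mul, map_zero] using RingQuot.mkAlgHom_rel k (TRel.orth (k := k) i j h)

lemma sum_eT : ∑ i, eT k n i = 1 := by
  simpa only [eT, map_sum, map_one] using RingQuot.mkAlgHom_rel k (TRel.esum (k := k) (n := n))

lemma eT_zero_mul_aT (i : Fin n) : eT k n 0 * aT k n i = aT k n i := by
  simpa only [eT, aT, asT, tinvT, TT, map_mul] using RingQuot.mkAlgHom_rel k (TRel.aL (k := k) i)

lemma aT_mul_eT (i : Fin n) : aT k n i * eT k n i.succ = aT k n i := by
  simpa only [eT, aT, asT, tinvT, TT, map_mul] using RingQuot.mkAlgHom_rel k (TRel.aR (k := k) i)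

lemma eT_mul_asT (i : Fin n) : eT k n i.succ * asT k n i = asT k n i := by
  simpa only [eT, aT, asT, tinvT, TT, map_mul] using RingQuot.mkAlgHom_rel k (TRel.asL (k := k) i)

lemma asT_mul_eT_zero (i : Fin n) : asT k n i * eT k n 0 = asT k n i := by
  simpa only [eT, aT, asT, tinvT, TT, map_mul] using RingQuot.mkAlgHom_rel k (TRel.asR (k := k) i)

lemma eT_zero_mul_tinvT (i : Fin n) : eT k n 0 * tinvT k n i = tinvT k n i := by
  simpa only [eT, aT, asT, tinvT, TT, map_mul] using RingQuot.mkAlgHom_rel k (TRel.tL (k := k) i)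

lemma tinvT_mul_eT_zero (i : Fin n) : tinvT k n i * eT k n 0 = tinvT k n i := by
  simpa only [eT, aT, asT, tinvT, TT, map_mul] using RingQuot.mkAlgHom_rel k (TRel.tR (k := k) i)

lemma TT_mul_tinvT (i : Fin n) : TT k n i * tinvT k n i = eT k n 0 := by
  simpa only [eT, aT, asT, tinvT, TT, map_mul, map_add] using RingQuot.mkAlgHom_rel k (TRel.tinvR (k := k) i)

lemma tinvT_mul_TT (i : Fin n) : tinvT k n i * TT k n i = eT k n 0 := by
  simpa only [eT, aT, asT, tinvT, TT, map_mul, map_add] using RingQuot.mkAlgHom_rel k (TRel.tinvL (k := k) i)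

lemma eT_zero_mul_TT (i : Fin n) : eT k n 0 * TT k n i = TT k n i := by
  rw [TT, mul_add, eT_mul_self, ← mul_assoc, eT_zero_mul_aT]

lemma TT_mul_eT_zero (i : Fin n) : TT k n i * eT k n 0 = TT k n i := by
  rw [TT, add_mul, eT_mul_self, mul_assoc, asT_mul_eT_zero]

lemma TT_mul_tinvT_mul (i : Fin n) (x : TAlg k n) :
    TT k n i * (tinvT k n i * x) = eT k n 0 * x := by
  rw [← mul_assoc, TT_mul_tinvT]

lemma tinvT_mul_TT_mul (i : Fin n) (x : TAlg k n) :
    tinvT k n i * (TT k n i * x) = eT k n 0 * x := by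
  rw [← mul_assoc, tinvT_mul_TT]

lemma asT_mul_eT_zero_mul (i : Fin n) (x : TAlg k n) :
    asT k n i * (eT k n 0 * x) = asT k n i * x := by
  rw [← mul_assoc, asT_mul_eT_zero]

end Relations

section Lift

variable {k} {n : ℕ} {B : Type*} [Ring B] [Algebra k B]

/-- Two algebra homomorphisms out of `Ã^{(n)}` agree as soon as they agree on the objects and on the
arrows `a_i`, `a_i^*`: the value on an inverse is forced. -/
lemma TAlg.algHom_ext {f g : TAlg k n →ₐ[k] B} (he : ∀ i, f (eT k n i) = g (eT k n i))
    (ha : ∀ i, f (aT k n i) = g (aT k n i)) (has : ∀ i, f (asT k n i) = g (asT k n i)) :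
    f = g := by
  have hT (i) : f (TT k n i) = g (TT k n i) := by
    simp only [TT, map_add, map_mul, he, ha, has]
  refine RingQuot.ringQuot_ext' k _ _ (FreeAlgebra.hom_ext (funext fun x => ?_))
  cases x with
  | e i => exact he i
  | a i => exact ha i
  | as i => exact has i
  | t i =>
    change f (tinvT k n i) = g (tinvT k n i)
    calc f (tinvT k n i) = f (tinvT k n i) * (g (TT k n i) * g (tinvT k n i)) := by
          rw [← map_mul g, TT_mul_tinvT, ← he, ← map_mul, tinvT_mul_eT_zero]
      _ = g (tinvT k n i) := by
          rw [← mul_assoc, ← hT, ← map_mul, tinvT_mul_TT, he, ← map_mul, eT_zero_mul_tinvT]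

/-- The image of a generator under the twisted relabelling given by `τ`, `π`, `L` and `R`. -/
noncomputable def twistGen (τ : Equiv.Perm (Fin (n + 1))) (π : Equiv.Perm (Fin n))
    (L R : Fin n → TAlg k n) : TGen n → TAlg k n
  | .e i => eT k n (τ i)
  | .a i => L i * aT k n (π i)
  | .as i => asT k n (π i) * R i
  | .t i => L i * tinvT k n (π i) * R i

/-- A permutation of the objects fixing `0`, together with mutually inverse endomorphisms
`L i`, `R i` of the object `0`. -/
structure IsTwist (τ : Equiv.Perm (Fin (n + 1))) (π : Equiv.Perm (Fin n))
    (L R : Fin n → TAlg k n) : Prop where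
  apply_zero : τ 0 = 0
  apply_succ (i) : τ i.succ = (π i).succ
  e_mul_L (i) : eT k n 0 * L i = L i
  R_mul_e (i) : R i * eT k n 0 = R i
  L_mul_R (i) : L i * R i = eT k n 0
  R_mul_L (i) : R i * L i = eT k n 0

variable {τ : Equiv.Perm (Fin (n + 1))} {π : Equiv.Perm (Fin n)} {L R : Fin n → TAlg k n}

lemma IsTwist.L_mul_eT_zero_mul_R (h : IsTwist τ π L R) (i : Fin n) :
    L i * eT k n 0 * R i = eT k n 0 := by
  rw [← h.R_mul_L i, ← mul_assoc, h.L_mul_R, mul_assoc, h.L_mul_R, eT_mul_self, h.R_mul_L]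

lemma IsTwist.L_mul_TT_mul_R (h : IsTwist τ π L R) (i : Fin n) :
    eT k n 0 + L i * aT k n (π i) * (asT k n (π i) * R i) = L i * TT k n (π i) * R i := by
  rw [TT, mul_add, add_mul, h.L_mul_eT_zero_mul_R]
  simp only [mul_assoc]

lemma IsTwist.lift_rel (h : IsTwist τ π L R) ⦃x y : FreeAlgebra k (TGen n)⦄ (hxy : TRel k n x y) :
    FreeAlgebra.lift k (twistGen τ π L R) x = FreeAlgebra.lift k (twistGen τ π L R) y := by
  have key (i) (X Y : TAlg k n) (hY : eT k n 0 * Y = Y) (hXY : X * Y = eT k n 0) :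
      L i * X * R i * (L i * Y * R i) = eT k n 0 := by
    calc L i * X * R i * (L i * Y * R i) = L i * X * (R i * L i * Y) * R i := by
          simp only [mul_assoc]
      _ = L i * (X * Y) * R i := by rw [h.R_mul_L, hY]; simp only [mul_assoc]
      _ = eT k n 0 := by rw [hXY, h.L_mul_eT_zero_mul_R]
  cases hxy <;>
    simp only [map_mul, map_add, map_sum, map_one, map_zero, FreeAlgebra.lift_ι_apply, twistGen,
      h.apply_zero, h.apply_succ]
  case idem i => exact eT_mul_self _
  case orth i j hij => exact eT_mul_of_ne (τ.injective.ne hij)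
  case esum => rw [Equiv.sum_comp τ (eT k n), sum_eT]
  case aL i => rw [← mul_assoc, h.e_mul_L]
  case aR i => rw [mul_assoc, aT_mul_eT]
  case asL i => rw [← mul_assoc, eT_mul_asT]
  case asR i => rw [mul_assoc, h.R_mul_e]
  case tL i => simp only [← mul_assoc, h.e_mul_L]
  case tR i => simp only [mul_assoc, h.R_mul_e]
  case tinvR i =>
    rw [h.L_mul_TT_mul_R]
    exact key i _ _ (eT_zero_mul_tinvT _) (TT_mul_tinvT _)
  case tinvL i =>
    rw [h.L_mul_TT_mul_R]
    exact key i _ _ (eT_zero_mul_TT _) (tinvT_mul_TT _)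

/-- The endomorphism of `Ã^{(n)}` with `a_i ↦ L_i a_{π i}` and `a_i^* ↦ a_{π i}^* R_i`. -/
noncomputable def IsTwist.hom (h : IsTwist τ π L R) : TAlg k n →ₐ[k] TAlg k n :=
  RingQuot.liftAlgHom k ⟨FreeAlgebra.lift k (twistGen τ π L R), h.lift_rel⟩

lemma IsTwist.hom_mkAlgHom (h : IsTwist τ π L R) (x : TGen n) :
    h.hom (RingQuot.mkAlgHom k (TRel k n) (FreeAlgebra.ι k x)) = twistGen τ π L R x := by
  rw [IsTwist.hom, RingQuot.liftAlgHom_mkAlgHom_apply, FreeAlgebra.lift_ι_apply]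

lemma IsTwist.hom_eT_zero (h : IsTwist τ π L R) : h.hom (eT k n 0) = eT k n 0 :=
  (h.hom_mkAlgHom _).trans (congrArg (eT k n) h.apply_zero)

lemma IsTwist.hom_eT_succ (h : IsTwist τ π L R) (i : Fin n) :
    h.hom (eT k n i.succ) = eT k n (π i).succ :=
  (h.hom_mkAlgHom _).trans (congrArg (eT k n) (h.apply_succ i))

lemma IsTwist.hom_aT (h : IsTwist τ π L R) (i : Fin n) :
    h.hom (aT k n i) = L i * aT k n (π i) :=
  h.hom_mkAlgHom _

lemma IsTwist.hom_asT (h : IsTwist τ π L R) (i : Fin n) :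
    h.hom (asT k n i) = asT k n (π i) * R i :=
  h.hom_mkAlgHom _

lemma IsTwist.hom_tinvT (h : IsTwist τ π L R) (i : Fin n) :
    h.hom (tinvT k n i) = L i * tinvT k n (π i) * R i :=
  h.hom_mkAlgHom _

lemma IsTwist.hom_TT (h : IsTwist τ π L R) (i : Fin n) :
    h.hom (TT k n i) = L i * TT k n (π i) * R i := by
  rw [← h.L_mul_TT_mul_R, TT, map_add, map_mul, h.hom_eT_zero, h.hom_aT, h.hom_asT]

end Lift

section GMV

variable {k} {n : ℕ}

lemma isTwist_update (p q r : Fin n) {x y : TAlg k n} (hx : eT k n 0 * x = x)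
    (hy : y * eT k n 0 = y) (hxy : x * y = eT k n 0) (hyx : y * x = eT k n 0) :
    IsTwist (Equiv.swap p.succ q.succ) (Equiv.swap p q)
      (Function.update (fun _ => eT k n 0) r x) (Function.update (fun _ => eT k n 0) r y) where
  apply_zero := Equiv.swap_apply_of_ne_of_ne (Fin.succ_ne_zero p).symm (Fin.succ_ne_zero q).symm
  apply_succ i := by
    simp only [Equiv.swap_apply_def, Fin.succ_inj]
    split_ifs <;> rfl
  e_mul_L i := by obtain rfl | h := eq_or_ne i r <;> simp [*, eT_mul_self]
  R_mul_e i := by obtain rfl | h := eq_or_ne i r <;> simp [*, eT_mul_self]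
  L_mul_R i := by obtain rfl | h := eq_or_ne i r <;> simp [*, eT_mul_self]
  R_mul_L i := by obtain rfl | h := eq_or_ne i r <;> simp [*, eT_mul_self]

variable (k) in
/-- The Gelfand–MacPherson–Vilonen functor on the pair of objects `p`, `q`:
`a_p ↦ T_p a_q` and `a_q ↦ a_p`. -/
noncomputable def gmvHom (p q : Fin n) : TAlg k n →ₐ[k] TAlg k n :=
  (isTwist_update p q p (eT_zero_mul_TT p) (tinvT_mul_eT_zero p) (TT_mul_tinvT p)
    (tinvT_mul_TT p)).hom

variable (k) in
/-- The inverse of `gmvHom`: `a_p ↦ a_q` and `a_q ↦ T_q^{-1} a_p`. -/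
noncomputable def gmvInvHom (p q : Fin n) : TAlg k n →ₐ[k] TAlg k n :=
  (isTwist_update p q q (eT_zero_mul_tinvT q) (TT_mul_eT_zero q) (tinvT_mul_TT q)
    (TT_mul_tinvT q)).hom

variable {p q : Fin n}

lemma gmvHom_eT_zero : gmvHom k p q (eT k n 0) = eT k n 0 := IsTwist.hom_eT_zero _

lemma gmvHom_eT_succ (i : Fin n) :
    gmvHom k p q (eT k n i.succ) = eT k n (Equiv.swap p q i).succ := IsTwist.hom_eT_succ _ i

lemma gmvHom_aT_left : gmvHom k p q (aT k n p) = TT k n p * aT k n q := by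
  simp [gmvHom, IsTwist.hom_aT]

lemma gmvHom_asT_left : gmvHom k p q (asT k n p) = asT k n q * tinvT k n p := by
  simp [gmvHom, IsTwist.hom_asT]

lemma gmvHom_TT_left :
    gmvHom k p q (TT k n p) = TT k n p * (TT k n q * tinvT k n p) := by
  simp [gmvHom, IsTwist.hom_TT, mul_assoc]

lemma gmvHom_tinvT_left :
    gmvHom k p q (tinvT k n p) = TT k n p * (tinvT k n q * tinvT k n p) := by
  simp [gmvHom, IsTwist.hom_tinvT, mul_assoc]

lemma gmvHom_aT_of_ne {i : Fin n} (hne : i ≠ p) :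
    gmvHom k p q (aT k n i) = aT k n (Equiv.swap p q i) := by
  simp [gmvHom, IsTwist.hom_aT, hne, eT_zero_mul_aT]

lemma gmvHom_asT_of_ne {i : Fin n} (hne : i ≠ p) :
    gmvHom k p q (asT k n i) = asT k n (Equiv.swap p q i) := by
  simp [gmvHom, IsTwist.hom_asT, hne, asT_mul_eT_zero]

lemma gmvHom_TT_of_ne {i : Fin n} (hne : i ≠ p) :
    gmvHom k p q (TT k n i) = TT k n (Equiv.swap p q i) := by
  simp [gmvHom, IsTwist.hom_TT, hne, eT_zero_mul_TT, TT_mul_eT_zero]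

lemma gmvHom_tinvT_of_ne {i : Fin n} (hne : i ≠ p) :
    gmvHom k p q (tinvT k n i) = tinvT k n (Equiv.swap p q i) := by
  simp [gmvHom, IsTwist.hom_tinvT, hne, eT_zero_mul_tinvT, tinvT_mul_eT_zero]

lemma gmvInvHom_eT_zero : gmvInvHom k p q (eT k n 0) = eT k n 0 := IsTwist.hom_eT_zero _

lemma gmvInvHom_eT_succ (i : Fin n) :
    gmvInvHom k p q (eT k n i.succ) = eT k n (Equiv.swap p q i).succ := IsTwist.hom_eT_succ _ i

lemma gmvInvHom_aT_right : gmvInvHom k p q (aT k n q) = tinvT k n q * aT k n p := by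
  simp [gmvInvHom, IsTwist.hom_aT]

lemma gmvInvHom_asT_right : gmvInvHom k p q (asT k n q) = asT k n p * TT k n q := by
  simp [gmvInvHom, IsTwist.hom_asT]

lemma gmvInvHom_aT_of_ne {i : Fin n} (hne : i ≠ q) :
    gmvInvHom k p q (aT k n i) = aT k n (Equiv.swap p q i) := by
  simp [gmvInvHom, IsTwist.hom_aT, hne, eT_zero_mul_aT]

lemma gmvInvHom_asT_of_ne {i : Fin n} (hne : i ≠ q) :
    gmvInvHom k p q (asT k n i) = asT k n (Equiv.swap p q i) := by
  simp [gmvInvHom, IsTwist.hom_asT, hne, asT_mul_eT_zero]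

lemma gmvInvHom_TT_of_ne {i : Fin n} (hne : i ≠ q) :
    gmvInvHom k p q (TT k n i) = TT k n (Equiv.swap p q i) := by
  simp [gmvInvHom, IsTwist.hom_TT, hne, eT_zero_mul_TT, TT_mul_eT_zero]

lemma gmvInvHom_tinvT_of_ne {i : Fin n} (hne : i ≠ q) :
    gmvInvHom k p q (tinvT k n i) = tinvT k n (Equiv.swap p q i) := by
  simp [gmvInvHom, IsTwist.hom_tinvT, hne, eT_zero_mul_tinvT, tinvT_mul_eT_zero]

lemma gmvHom_comp_gmvInvHom (h : p ≠ q) :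
    (gmvHom k p q).comp (gmvInvHom k p q) = AlgHom.id k (TAlg k n) := by
  refine TAlg.algHom_ext (fun i => ?_) (fun i => ?_) (fun i => ?_)
  · cases i using Fin.cases <;> simp [gmvHom_eT_zero, gmvInvHom_eT_zero, gmvHom_eT_succ,
      gmvInvHom_eT_succ]
  all_goals
    obtain rfl | hq := eq_or_ne i q
    · simp [gmvInvHom_aT_right, gmvInvHom_asT_right, gmvHom_aT_left, gmvHom_asT_left,
        gmvHom_TT_of_ne, gmvHom_tinvT_of_ne, h.symm, tinvT_mul_TT_mul, mul_assoc, tinvT_mul_TT,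
        eT_zero_mul_aT, asT_mul_eT_zero]
    obtain rfl | hp := eq_or_ne i p
    · simp [gmvInvHom_aT_of_ne, gmvInvHom_asT_of_ne, gmvHom_aT_of_ne, gmvHom_asT_of_ne, h, h.symm]
    · simp [gmvInvHom_aT_of_ne, gmvInvHom_asT_of_ne, gmvHom_aT_of_ne, gmvHom_asT_of_ne, hp, hq,
        Equiv.swap_apply_of_ne_of_ne]

lemma gmvInvHom_comp_gmvHom (h : p ≠ q) :
    (gmvInvHom k p q).comp (gmvHom k p q) = AlgHom.id k (TAlg k n) := by
  refine TAlg.algHom_ext (fun i => ?_) (fun i => ?_) (fun i => ?_)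
  · cases i using Fin.cases <;> simp [gmvHom_eT_zero, gmvInvHom_eT_zero, gmvHom_eT_succ,
      gmvInvHom_eT_succ]
  all_goals
    obtain rfl | hp := eq_or_ne i p
    · simp [gmvInvHom_aT_right, gmvInvHom_asT_right, gmvHom_aT_left, gmvHom_asT_left,
        gmvInvHom_TT_of_ne, gmvInvHom_tinvT_of_ne, h, TT_mul_tinvT_mul, mul_assoc, TT_mul_tinvT,
        eT_zero_mul_aT, asT_mul_eT_zero]
    obtain rfl | hq := eq_or_ne i q
    · simp [gmvInvHom_aT_of_ne, gmvInvHom_asT_of_ne, gmvHom_aT_of_ne, gmvHom_asT_of_ne, h, h.symm]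
    · simp [gmvInvHom_aT_of_ne, gmvInvHom_asT_of_ne, gmvHom_aT_of_ne, gmvHom_asT_of_ne, hp, hq,
        Equiv.swap_apply_of_ne_of_ne]

/-- The Gelfand–MacPherson–Vilonen automorphism on the pair of distinct objects `p`, `q`. -/
noncomputable def gmvEquiv (h : p ≠ q) : TAlg k n ≃ₐ[k] TAlg k n :=
  AlgEquiv.ofAlgHom (gmvHom k p q) (gmvInvHom k p q) (gmvHom_comp_gmvInvHom h)
    (gmvInvHom_comp_gmvHom h)

lemma gmvHom_braid {r : Fin n} (hpq : p ≠ q) (hqr : q ≠ r) (hpr : p ≠ r) :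
    (gmvHom k p q).comp ((gmvHom k q r).comp (gmvHom k p q)) =
      (gmvHom k q r).comp ((gmvHom k p q).comp (gmvHom k q r)) := by
  have hs₁ : Equiv.swap p q r = r := Equiv.swap_apply_of_ne_of_ne hpr.symm hqr.symm
  have hs₂ : Equiv.swap q r p = p := Equiv.swap_apply_of_ne_of_ne hpq hpr
  have hs (i) (hp : i ≠ p) (hq : i ≠ q) (hr : i ≠ r) :
      Equiv.swap p q i = i ∧ Equiv.swap q r i = i :=
    ⟨Equiv.swap_apply_of_ne_of_ne hp hq, Equiv.swap_apply_of_ne_of_ne hq hr⟩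
  refine TAlg.algHom_ext (fun i => ?_) (fun i => ?_) (fun i => ?_)
  · cases i using Fin.cases with
    | zero => simp [gmvHom_eT_zero]
    | succ i =>
      by_cases hp : i = p
      · simp [gmvHom_eT_succ, hp, hs₁, hs₂]
      by_cases hq : i = q
      · simp [gmvHom_eT_succ, hq, hs₁, hs₂]
      by_cases hr : i = r
      · simp [gmvHom_eT_succ, hr, hs₁, hs₂]
      simp [gmvHom_eT_succ, hs i hp hq hr]
  all_goals
    by_cases hp : i = p
    · simp [hp, gmvHom_aT_left, gmvHom_asT_left, gmvHom_TT_left, gmvHom_tinvT_left,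
        gmvHom_aT_of_ne, gmvHom_asT_of_ne, gmvHom_TT_of_ne, gmvHom_tinvT_of_ne, hs₁, hs₂, hpq,
        hpq.symm, hpr.symm, mul_assoc, tinvT_mul_TT_mul, eT_zero_mul_aT,
        asT_mul_eT_zero_mul]
    by_cases hq : i = q
    · simp [hq, gmvHom_aT_left, gmvHom_asT_left, gmvHom_TT_of_ne, gmvHom_tinvT_of_ne,
        gmvHom_aT_of_ne, gmvHom_asT_of_ne, hs₁, hs₂, hpq, hpq.symm, hpr.symm, hqr.symm]
    by_cases hr : i = r
    · simp [hr, gmvHom_aT_of_ne, gmvHom_asT_of_ne, hs₁, hs₂, hpq, hpq.symm, hpr.symm, hqr.symm]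
    simp [gmvHom_aT_of_ne, gmvHom_asT_of_ne, hp, hq, hs i hp hq hr]

lemma gmvHom_comm {r s : Fin n} (hpr : p ≠ r) (hps : p ≠ s) (hqr : q ≠ r)
    (hqs : q ≠ s) :
    (gmvHom k p q).comp (gmvHom k r s) = (gmvHom k r s).comp (gmvHom k p q) := by
  have hp : Equiv.swap r s p = p := Equiv.swap_apply_of_ne_of_ne hpr hps
  have hq : Equiv.swap r s q = q := Equiv.swap_apply_of_ne_of_ne hqr hqs
  have hr : Equiv.swap p q r = r := Equiv.swap_apply_of_ne_of_ne hpr.symm hqr.symm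
  have hs : Equiv.swap p q s = s := Equiv.swap_apply_of_ne_of_ne hps.symm hqs.symm
  have hcomm (i : Fin n) :
      Equiv.swap p q (Equiv.swap r s i) = Equiv.swap r s (Equiv.swap p q i) := by
    rw [← (Equiv.swap p q).injective.swap_apply, hr, hs]
  refine TAlg.algHom_ext (fun i => ?_) (fun i => ?_) (fun i => ?_)
  · cases i using Fin.cases <;> simp [gmvHom_eT_zero, gmvHom_eT_succ, hcomm]
  all_goals
    by_cases hip : i = p
    · simp [hip, gmvHom_aT_left, gmvHom_asT_left, gmvHom_aT_of_ne, gmvHom_asT_of_ne,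
        gmvHom_TT_of_ne, gmvHom_tinvT_of_ne, hp, hq, hpr, hqr]
    by_cases hir : i = r
    · simp [hir, gmvHom_aT_left, gmvHom_asT_left, gmvHom_aT_of_ne, gmvHom_asT_of_ne,
        gmvHom_TT_of_ne, gmvHom_tinvT_of_ne, hr, hs, hpr.symm, hps.symm]
    have h₁ : Equiv.swap r s i ≠ p := fun h => hip (by rw [← Equiv.swap_apply_self r s i, h, hp])
    have h₂ : Equiv.swap p q i ≠ r := fun h => hir (by rw [← Equiv.swap_apply_self p q i, h, hr])
    simp [gmvHom_aT_of_ne, gmvHom_asT_of_ne, hip, hir, h₁, h₂, hcomm]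

lemma lo_ne_hi (i : Fin (n - 1)) : lo i ≠ hi i := by simp [lo, hi]

lemma isGMVAt_gmvEquiv (i : Fin (n - 1)) :
    IsGMVAt k n i (gmvEquiv (k := k) (lo_ne_hi i)) := by
  change IsGMVAt k n i (gmvHom k (lo i) (hi i))
  refine ⟨gmvHom_eT_zero, ?_, ?_, fun j h₁ h₂ => ?_, gmvHom_aT_left, ?_, gmvHom_asT_left, ?_,
    fun j h₁ h₂ => ?_⟩
  · simp [gmvHom_eT_succ]
  · simp [gmvHom_eT_succ]
  · rw [gmvHom_eT_succ, Equiv.swap_apply_of_ne_of_ne h₁ h₂]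
  · simp [gmvHom_aT_of_ne (lo_ne_hi i).symm]
  · simp [gmvHom_asT_of_ne (lo_ne_hi i).symm]
  · simp [gmvHom_aT_of_ne h₁, gmvHom_asT_of_ne h₁, Equiv.swap_apply_of_ne_of_ne h₁ h₂]

end GMV

theorem statement3 (n : ℕ) :
    ∃ σ : Fin (n - 1) → (TAlg k n ≃ₐ[k] TAlg k n),
      -- each σ_i is a well-defined invertible k-linear functor given by the GMV
      -- assignments
      (∀ i : Fin (n - 1), IsGMVAt k n i (σ i)) ∧
      -- the braid relations σ_iσ_{i+1}σ_i = σ_{i+1}σ_iσ_{i+1} …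
      (∀ i j : Fin (n - 1), (i : ℕ) + 1 = (j : ℕ) →
        ∀ x, σ i (σ j (σ i x)) = σ j (σ i (σ j x))) ∧
      -- … and σ_iσ_j = σ_jσ_i for |i−j| ≥ 2
      (∀ i j : Fin (n - 1), (i : ℕ) + 2 ≤ (j : ℕ) →
        ∀ x, σ i (σ j x) = σ j (σ i x)) ∧
      -- hence a left action of B_n on Ã^{(n)}
      ∃ ρ : BraidGroup n →* (TAlg k n ≃ₐ[k] TAlg k n),
        ∀ i : Fin (n - 1), ρ (braidGen i) = σ i := by
  have braid (i j : Fin (n - 1)) (h : (i : ℕ) + 1 = (j : ℕ)) (x : TAlg k n) :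
      gmvEquiv (lo_ne_hi i) (gmvEquiv (lo_ne_hi j) (gmvEquiv (lo_ne_hi i) x)) =
        gmvEquiv (lo_ne_hi j) (gmvEquiv (lo_ne_hi i) (gmvEquiv (lo_ne_hi j) x)) := by
    have hij : lo j = hi i := Fin.ext h.symm
    have hne : lo i ≠ hi j := by simp only [lo, hi, ne_eq, Fin.mk.injEq]; omega
    have hqr : hi i ≠ hi j := hij ▸ lo_ne_hi j
    change gmvHom k (lo i) (hi i) (gmvHom k (lo j) (hi j) (gmvHom k (lo i) (hi i) x)) =
      gmvHom k (lo j) (hi j) (gmvHom k (lo i) (hi i) (gmvHom k (lo j) (hi j) x))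
    rw [hij]
    exact DFunLike.congr_fun (gmvHom_braid (lo_ne_hi i) hqr hne) x
  have comm (i j : Fin (n - 1)) (h : (i : ℕ) + 2 ≤ (j : ℕ)) (x : TAlg k n) :
      gmvEquiv (lo_ne_hi i) (gmvEquiv (lo_ne_hi j) x) =
        gmvEquiv (lo_ne_hi j) (gmvEquiv (lo_ne_hi i) x) := by
    refine DFunLike.congr_fun (gmvHom_comm (k := k) ?_ ?_ ?_ ?_) x <;>
      simp only [lo, hi, ne_eq, Fin.mk.injEq] <;> omega
  refine ⟨fun i => gmvEquiv (lo_ne_hi i), isGMVAt_gmvEquiv, braid, comm,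
    PresentedGroup.toGroup (f := fun i => gmvEquiv (lo_ne_hi i)) ?_,
    fun i => PresentedGroup.toGroup.of _⟩
  rintro r (⟨i, j, h, rfl⟩ | ⟨i, j, h, rfl⟩)
  · simp only [map_mul, map_inv, FreeGroup.lift_apply_of]
    exact mul_inv_eq_one.2 (AlgEquiv.ext (braid i j h))
  · simp only [map_mul, map_inv, FreeGroup.lift_apply_of]
    rw [mul_inv_eq_one, mul_inv_eq_iff_eq_mul]
    exact AlgEquiv.ext (comm i j h)
end

section
/- Fix units μ, λ ∈ k^×. The identity-on-objects k-linear automorphism θ_λ : A → A defined by a ↦ λ^{-1}a and a^* ↦ λa^* is σ-natural for the μ-central GMV operator σ : A^{(2)} → A^{(2)}: one has the equalities of functors σ ∘ (θ_λ ⊔ id_A) = (id_A ⊔ θ_λ) ∘ σ and σ ∘ (id_A ⊔ θ_λ) = (θ_λ ⊔ id_A) ∘ σ from A^{(2)} to A^{(2)}. -/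
/-!
STATEMENT 7: For units μ, λ ∈ k^×, the identity-on-objects k-linear automorphism
θ_λ : A → A, a ↦ λ⁻¹a, a^* ↦ λa^*, is σ-natural for the μ-central GMV operator
σ : A^{(2)} → A^{(2)}: σ ∘ (θ_λ ⊔ id) = (id ⊔ θ_λ) ∘ σ and
σ ∘ (id ⊔ θ_λ) = (θ_λ ⊔ id) ∘ σ.
-/

/-- Generators of the `k`-category `A^{(n)}` with two objects `{0,1}` (encoded as
a `k`-algebra with idempotents `e₀, e₁`): the identities `e₀, e₁` and the arrows
`a_i : 1 → 0`, `a_i^* : 0 → 1`. -/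
inductive PGen (n : ℕ) : Type
  | e0 : PGen n
  | e1 : PGen n
  | a : Fin n → PGen n
  | as : Fin n → PGen n

variable (k : Type) [CommRing k]

/-- The defining relations of `A^{(n)}`: `e₀, e₁` are orthogonal idempotents
summing to `1` (encoding the two objects), the arrows are placed in the correct
hom-components (`a_i = e₀ a_i e₁`, `a_i^* = e₁ a_i^* e₀`), and the μ-central
relations `a_i^* a_i = (μ − 1) e₁` hold. -/
inductive PRel (μ : k) (n : ℕ) : FreeAlgebra k (PGen n) → FreeAlgebra k (PGen n) → Prop
  | idem0 : PRel μ n (FreeAlgebra.ι k PGen.e0 * FreeAlgebra.ι k PGen.e0) (FreeAlgebra.ι k PGen.e0)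
  | idem1 : PRel μ n (FreeAlgebra.ι k PGen.e1 * FreeAlgebra.ι k PGen.e1) (FreeAlgebra.ι k PGen.e1)
  | orth01 : PRel μ n (FreeAlgebra.ι k PGen.e0 * FreeAlgebra.ι k PGen.e1) 0
  | orth10 : PRel μ n (FreeAlgebra.ι k PGen.e1 * FreeAlgebra.ι k PGen.e0) 0
  | esum : PRel μ n (FreeAlgebra.ι k PGen.e0 + FreeAlgebra.ι k PGen.e1) 1
  | aL (i : Fin n) :
      PRel μ n (FreeAlgebra.ι k PGen.e0 * FreeAlgebra.ι k (PGen.a i)) (FreeAlgebra.ι k (PGen.a i))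
  | aR (i : Fin n) :
      PRel μ n (FreeAlgebra.ι k (PGen.a i) * FreeAlgebra.ι k PGen.e1) (FreeAlgebra.ι k (PGen.a i))
  | asL (i : Fin n) :
      PRel μ n (FreeAlgebra.ι k PGen.e1 * FreeAlgebra.ι k (PGen.as i)) (FreeAlgebra.ι k (PGen.as i))
  | asR (i : Fin n) :
      PRel μ n (FreeAlgebra.ι k (PGen.as i) * FreeAlgebra.ι k PGen.e0) (FreeAlgebra.ι k (PGen.as i))
  | mu (i : Fin n) :
      PRel μ n (FreeAlgebra.ι k (PGen.as i) * FreeAlgebra.ι k (PGen.a i))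
        ((μ - 1) • FreeAlgebra.ι k PGen.e1)

/-- The `k`-category `A^{(n)}` (the μ-central quotient with two objects `{0,1}`),
encoded as a `k`-algebra with idempotents: the `n`-fold coproduct of copies of
`A = A^{(1)}` in the category of `k`-categories with object set `{0,1}`. -/
abbrev PAlg (μ : k) (n : ℕ) : Type := RingQuot (PRel k μ n)

/-- The idempotent `e₀` (identity of the object `0`). -/
noncomputable def e0P (μ : k) (n : ℕ) : PAlg k μ n :=
  RingQuot.mkAlgHom k (PRel k μ n) (FreeAlgebra.ι k PGen.e0)

/-- The idempotent `e₁` (identity of the object `1`). -/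
noncomputable def e1P (μ : k) (n : ℕ) : PAlg k μ n :=
  RingQuot.mkAlgHom k (PRel k μ n) (FreeAlgebra.ι k PGen.e1)

/-- The generating morphism `a_i : 1 → 0`. -/
noncomputable def aP (μ : k) (n : ℕ) (i : Fin n) : PAlg k μ n :=
  RingQuot.mkAlgHom k (PRel k μ n) (FreeAlgebra.ι k (PGen.a i))

/-- The generating morphism `a_i^* : 0 → 1`. -/
noncomputable def asP (μ : k) (n : ℕ) (i : Fin n) : PAlg k μ n :=
  RingQuot.mkAlgHom k (PRel k μ n) (FreeAlgebra.ι k (PGen.as i))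

/-- The invertible endomorphism `T_i = e₀ + a_i a_i^*` of the object `0`. -/
noncomputable def TP (μ : k) (n : ℕ) (i : Fin n) : PAlg k μ n :=
  e0P k μ n + aP k μ n i * asP k μ n i

/-- The inverse `T_i^{-1} = e₀ − μ^{-1} a_i a_i^*` of `T_i` (for `μ` a unit). -/
noncomputable def TinvP (μ : kˣ) (n : ℕ) (i : Fin n) : PAlg k (μ : k) n :=
  e0P k (μ : k) n - ((μ⁻¹ : kˣ) : k) • (aP k (μ : k) n i * asP k (μ : k) n i)

/-- The μ-central GMV assignments for the generator `σ_i` acting on `A^{(n)}`: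
it fixes both objects `0` and `1` and sends `a_i ↦ T_i a_{i+1}`, `a_{i+1} ↦ a_i`,
`a_i^* ↦ a_{i+1}^* T_i^{-1}`, `a_{i+1}^* ↦ a_i^*`, fixing `a_j, a_j^*` for
`j ≠ i, i+1`. -/
def IsMuGMVAt (μ : kˣ) (n : ℕ) (i : Fin (n - 1))
    (σ : PAlg k (μ : k) n → PAlg k (μ : k) n) : Prop :=
  σ (e0P k (μ : k) n) = e0P k (μ : k) n ∧
  σ (e1P k (μ : k) n) = e1P k (μ : k) n ∧
  σ (aP k (μ : k) n (lo i)) = TP k (μ : k) n (lo i) * aP k (μ : k) n (hi i) ∧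
  σ (aP k (μ : k) n (hi i)) = aP k (μ : k) n (lo i) ∧
  σ (asP k (μ : k) n (lo i)) = asP k (μ : k) n (hi i) * TinvP k μ n (lo i) ∧
  σ (asP k (μ : k) n (hi i)) = asP k (μ : k) n (lo i) ∧
  (∀ j : Fin n, j ≠ lo i → j ≠ hi i →
    σ (aP k (μ : k) n j) = aP k (μ : k) n j ∧ σ (asP k (μ : k) n j) = asP k (μ : k) n j)

/-- The coproduct functor `θ_λ ⊔ θ_ν : A^{(2)} → A^{(2)}` applying the rescaling
`a ↦ λ⁻¹a, a^* ↦ λa^*` on the first copy of the generators and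
`a ↦ ν⁻¹a, a^* ↦ νa^*` on the second. -/
def IsThetaPair (μ : kˣ) (lam nu : kˣ) (θ : PAlg k (μ : k) 2 → PAlg k (μ : k) 2) : Prop :=
  θ (e0P k (μ : k) 2) = e0P k (μ : k) 2 ∧
  θ (e1P k (μ : k) 2) = e1P k (μ : k) 2 ∧
  θ (aP k (μ : k) 2 0) = ((lam⁻¹ : kˣ) : k) • aP k (μ : k) 2 0 ∧
  θ (asP k (μ : k) 2 0) = ((lam : kˣ) : k) • asP k (μ : k) 2 0 ∧
  θ (aP k (μ : k) 2 1) = ((nu⁻¹ : kˣ) : k) • aP k (μ : k) 2 1 ∧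
  θ (asP k (μ : k) 2 1) = ((nu : kˣ) : k) • asP k (μ : k) 2 1

/-- Algebra endomorphisms of `PAlg k μ 2` agreeing on the generators are equal. -/
theorem PAlg.algHom_ext_two {μ : k} {f g : PAlg k μ 2 →ₐ[k] PAlg k μ 2}
    (h0 : f (e0P k μ 2) = g (e0P k μ 2)) (h1 : f (e1P k μ 2) = g (e1P k μ 2))
    (ha : ∀ i, f (aP k μ 2 i) = g (aP k μ 2 i))
    (has : ∀ i, f (asP k μ 2 i) = g (asP k μ 2 i)) : f = g := by
  apply RingQuot.ringQuot_ext'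
  apply FreeAlgebra.hom_ext
  funext x
  cases x with
  | e0 => exact h0
  | e1 => exact h1
  | a i => exact ha i
  | as i => exact has i

/-- If `θ` is the rescaling by `(lam, nu)` and `θ'` the rescaling by `(nu, lam)`, then the
GMV operator intertwines them. -/
theorem IsMuGMVAt.comp_thetaPair {μ lam nu : kˣ}
    {σ θ θ' : PAlg k (μ : k) 2 →ₐ[k] PAlg k (μ : k) 2}
    (hσ : IsMuGMVAt k μ 2 0 (σ : PAlg k (μ : k) 2 → PAlg k (μ : k) 2))
    (hθ : IsThetaPair k μ lam nu (θ : PAlg k (μ : k) 2 → PAlg k (μ : k) 2))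
    (hθ' : IsThetaPair k μ nu lam (θ' : PAlg k (μ : k) 2 → PAlg k (μ : k) 2)) :
    σ.comp θ = θ'.comp σ := by
  obtain ⟨s0, s1, sa0, sa1, sb0, sb1, -⟩ := hσ
  obtain ⟨t0, t1, ta0, tb0, ta1, tb1⟩ := hθ
  obtain ⟨u0, u1, ua0, ub0, ua1, ub1⟩ := hθ'
  have hlo : lo (0 : Fin (2 - 1)) = 0 := rfl
  have hhi : hi (0 : Fin (2 - 1)) = 1 := rfl
  rw [hlo, hhi] at sa0 sb0
  rw [hlo, hhi] at sa1 sb1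
  have hab : θ' (aP k (μ : k) 2 0 * asP k (μ : k) 2 0) = aP k (μ : k) 2 0 * asP k (μ : k) 2 0 := by
    rw [map_mul, ua0, ub0, smul_mul_smul_comm, Units.inv_mul, one_smul]
  have hT : θ' (TP k (μ : k) 2 0) = TP k (μ : k) 2 0 := by
    rw [TP, map_add, u0, hab]
  have hTinv : θ' (TinvP k μ 2 0) = TinvP k μ 2 0 := by
    rw [TinvP, map_sub, map_smul, u0, hab]
  apply PAlg.algHom_ext_two
  · simp only [AlgHom.comp_apply, t0, s0, u0]
  · simp only [AlgHom.comp_apply, t1, s1, u1]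
  · rw [Fin.forall_fin_two]
    constructor
    · rw [AlgHom.comp_apply, AlgHom.comp_apply, ta0, map_smul, sa0, map_mul, hT, ua1,
        mul_smul_comm]
    · rw [AlgHom.comp_apply, AlgHom.comp_apply, ta1, map_smul, sa1, ua0]
  · rw [Fin.forall_fin_two]
    constructor
    · rw [AlgHom.comp_apply, AlgHom.comp_apply, tb0, map_smul, sb0, map_mul, hTinv, ub1,
        smul_mul_assoc]
    · rw [AlgHom.comp_apply, AlgHom.comp_apply, tb1, map_smul, sb1, ub0]

theorem statement7 (μ lam : kˣ)
    -- σ : A^{(2)} → A^{(2)} is the μ-central GMV operator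
    (σ : PAlg k (μ : k) 2 →ₐ[k] PAlg k (μ : k) 2)
    (hσ : IsMuGMVAt k μ 2 0 (σ : PAlg k (μ : k) 2 → PAlg k (μ : k) 2))
    -- θ₁ = θ_λ ⊔ id and θ₂ = id ⊔ θ_λ
    (θ₁ θ₂ : PAlg k (μ : k) 2 →ₐ[k] PAlg k (μ : k) 2)
    (hθ₁ : IsThetaPair k μ lam 1 (θ₁ : PAlg k (μ : k) 2 → PAlg k (μ : k) 2))
    (hθ₂ : IsThetaPair k μ 1 lam (θ₂ : PAlg k (μ : k) 2 → PAlg k (μ : k) 2)) :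
    -- σ ∘ (θ_λ ⊔ id) = (id ⊔ θ_λ) ∘ σ  and  σ ∘ (id ⊔ θ_λ) = (θ_λ ⊔ id) ∘ σ
    (∀ x, σ (θ₁ x) = θ₂ (σ x)) ∧ (∀ x, σ (θ₂ x) = θ₁ (σ x)) := by
  exact ⟨DFunLike.congr_fun (IsMuGMVAt.comp_thetaPair k hσ hθ₁ hθ₂),
    DFunLike.congr_fun (IsMuGMVAt.comp_thetaPair k hσ hθ₂ hθ₁)⟩
end

section
/- Fix a unit μ ∈ k^×. For 1 ≤ i, j ≤ n set A_{ij} := −a_i^* a_j ∈ A^{(n)}(1,1) (the negative of the composite of a_j : 1 → 0 followed by a_i^* : 0 → 1). Then the endomorphism k-algebra A^{(n)}(1,1) of the object 1 is isomorphic to the quotient of the free associative k-algebra on generators A_{ij} (1 ≤ i,j ≤ n) by the relations A_{ii} = (1−μ)·1; equivalently, setting a_{ij} := A_{ij} for i < j and a_{ij} := −μ^{-1}A_{ij} for i > j, the algebra A^{(n)}(1,1) is a free associative k-algebra on the n(n−1) generators a_{ij} (i ≠ j). -/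
variable (k : Type) [CommRing k]

/-- The relations `A_{ii} = (1 − μ)·1` imposed on the free associative algebra on
the generators `A_{ij}`. -/
inductive ARel (μ : k) (n : ℕ) :
    FreeAlgebra k (Fin n × Fin n) → FreeAlgebra k (Fin n × Fin n) → Prop
  | diag (i : Fin n) :
      ARel μ n (FreeAlgebra.ι k (i, i)) (algebraMap k (FreeAlgebra k (Fin n × Fin n)) (1 - μ))

/-- The quotient of the free associative `k`-algebra on generators `A_{ij}`
`(1 ≤ i,j ≤ n)` by the relations `A_{ii} = (1−μ)·1`. -/
abbrev AQuot (μ : k) (n : ℕ) : Type := RingQuot (ARel k μ n)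

section Relations

variable {k} {μ : k} {n : ℕ}

-- The negation found on `PAlg` is not syntactically that of its ring structure, so `rw` needs
-- these restatements of the general lemmas.

theorem PAlg.neg_mul (x y : PAlg k μ n) : -x * y = -(x * y) := _root_.neg_mul x y

theorem PAlg.mul_neg (x y : PAlg k μ n) : x * -y = -(x * y) := _root_.mul_neg x y

theorem PAlg.neg_smul (r : k) (x : PAlg k μ n) : -(r • x) = -r • x := (_root_.neg_smul r x).symm

theorem e0P_mul_e0P : e0P k μ n * e0P k μ n = e0P k μ n := by
  simpa [e0P] using RingQuot.mkAlgHom_rel k (PRel.idem0 (μ := μ) (n := n))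

theorem e1P_mul_e1P : e1P k μ n * e1P k μ n = e1P k μ n := by
  simpa [e1P] using RingQuot.mkAlgHom_rel k (PRel.idem1 (μ := μ) (n := n))

theorem e0P_mul_e1P : e0P k μ n * e1P k μ n = 0 := by
  simpa [e0P, e1P] using RingQuot.mkAlgHom_rel k (PRel.orth01 (μ := μ) (n := n))

theorem e1P_mul_e0P : e1P k μ n * e0P k μ n = 0 := by
  simpa [e0P, e1P] using RingQuot.mkAlgHom_rel k (PRel.orth10 (μ := μ) (n := n))

theorem e0P_add_e1P : e0P k μ n + e1P k μ n = 1 := by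
  simpa [e0P, e1P] using RingQuot.mkAlgHom_rel k (PRel.esum (μ := μ) (n := n))

theorem e0P_mul_aP (i : Fin n) : e0P k μ n * aP k μ n i = aP k μ n i := by
  simpa [e0P, aP] using RingQuot.mkAlgHom_rel k (PRel.aL (μ := μ) i)

theorem aP_mul_e1P (i : Fin n) : aP k μ n i * e1P k μ n = aP k μ n i := by
  simpa [e1P, aP] using RingQuot.mkAlgHom_rel k (PRel.aR (μ := μ) i)

theorem e1P_mul_asP (i : Fin n) : e1P k μ n * asP k μ n i = asP k μ n i := by
  simpa [e1P, asP] using RingQuot.mkAlgHom_rel k (PRel.asL (μ := μ) i)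

theorem asP_mul_e0P (i : Fin n) : asP k μ n i * e0P k μ n = asP k μ n i := by
  simpa [e0P, asP] using RingQuot.mkAlgHom_rel k (PRel.asR (μ := μ) i)

theorem asP_mul_aP_self (i : Fin n) :
    asP k μ n i * aP k μ n i = (μ - 1) • e1P k μ n := by
  simpa only [map_mul, map_smul, e1P, aP, asP] using
    RingQuot.mkAlgHom_rel k (PRel.mu (μ := μ) i)

theorem e1P_mul_aP (i : Fin n) : e1P k μ n * aP k μ n i = 0 := by
  rw [← e0P_mul_aP, ← mul_assoc, e1P_mul_e0P, zero_mul]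

theorem asP_mul_e1P (i : Fin n) : asP k μ n i * e1P k μ n = 0 := by
  rw [← asP_mul_e0P, mul_assoc, e0P_mul_e1P, mul_zero]

theorem aP_mul_aP (i j : Fin n) : aP k μ n i * aP k μ n j = 0 := by
  rw [← aP_mul_e1P, mul_assoc, e1P_mul_aP, mul_zero]

/-- A subalgebra of `A^{(n)}` containing the generators is everything. -/
theorem PAlg.subalgebra_eq_top (S : Subalgebra k (PAlg k μ n)) (h0 : e0P k μ n ∈ S)
    (h1 : e1P k μ n ∈ S) (ha : ∀ i, aP k μ n i ∈ S) (has : ∀ i, asP k μ n i ∈ S) :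
    S = ⊤ := by
  refine top_unique fun z _ => ?_
  obtain ⟨w, rfl⟩ := RingQuot.mkAlgHom_surjective k (PRel k μ n) z
  induction w using FreeAlgebra.induction with
  | grade0 r => simpa only [AlgHom.commutes] using S.algebraMap_mem r
  | grade1 x =>
    cases x with
    | e0 => exact h0
    | e1 => exact h1
    | a i => exact ha i
    | as i => exact has i
  | mul x y hx hy => simpa only [map_mul] using S.mul_mem (hx trivial) (hy trivial)
  | add x y hx hy => simpa only [map_add] using S.add_mem (hx trivial) (hy trivial)

end Relations

section Corner

variable {k} {μ : k} {n : ℕ} {B : Type} [Ring B] [Algebra k B]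

/-- The images of the generators of `A^{(n)}` in the matrices over an algebra `B` with elements
`A i j`: the object `1` acts on `B`, the object `0` on `B ^ n`, `a_j` is the inclusion of the
`j`-th summand and `a_i^*` is the row `-A i`. -/
def cornerGen (A : Fin n → Fin n → B) :
    PGen n → Matrix (Unit ⊕ Fin n) (Unit ⊕ Fin n) B
  | PGen.e0 => Matrix.fromBlocks 0 0 0 1
  | PGen.e1 => Matrix.fromBlocks 1 0 0 0
  | PGen.a j => Matrix.fromBlocks 0 0 (Matrix.of fun i _ => if i = j then 1 else 0) 0
  | PGen.as i => Matrix.fromBlocks 0 (Matrix.of fun _ j => -A i j) 0 0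

/-- The matrix representation of `A^{(n)}` over an algebra `B` with elements `A i j` such that
`A i i = 1 - μ`. -/
noncomputable def cornerRep (A : Fin n → Fin n → B)
    (hA : ∀ i, A i i = algebraMap k B (1 - μ)) :
    PAlg k μ n →ₐ[k] Matrix (Unit ⊕ Fin n) (Unit ⊕ Fin n) B :=
  RingQuot.liftAlgHom k ⟨FreeAlgebra.lift k (cornerGen A), by
    intro x y h
    cases h with
    | mu i =>
      simp only [map_mul, map_smul, FreeAlgebra.lift_ι_apply, cornerGen,
        Matrix.fromBlocks_multiply, Matrix.fromBlocks_smul]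
      congr 1 <;> ext <;> simp [Matrix.mul_apply, hA, Algebra.smul_def]
    | _ =>
      simp [cornerGen, Matrix.fromBlocks_multiply, Matrix.fromBlocks_add]⟩

theorem cornerRep_e1P (A : Fin n → Fin n → B) (hA : ∀ i, A i i = algebraMap k B (1 - μ)) :
    cornerRep A hA (e1P k μ n) = Matrix.fromBlocks 1 0 0 0 := by
  simp [cornerRep, e1P, cornerGen]

theorem cornerRep_asP_mul_aP (A : Fin n → Fin n → B)
    (hA : ∀ i, A i i = algebraMap k B (1 - μ)) (i j : Fin n) :
    cornerRep A hA (asP k μ n i * aP k μ n j) =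
      Matrix.fromBlocks (Matrix.of fun _ _ => -A i j) 0 0 0 := by
  simp only [cornerRep, asP, aP, map_mul, RingQuot.liftAlgHom_mkAlgHom_apply,
    FreeAlgebra.lift_ι_apply, cornerGen, Matrix.fromBlocks_multiply]
  congr 1 <;> ext <;> simp [Matrix.mul_apply]

/-- The element of `A^{(n)}` acting as `-a_i^* a_j` on the object `1`, and on the object `0` as
the scalar that makes the diagonal elements equal to `1 - μ`. -/
noncomputable def extA (μ : k) (n : ℕ) (i j : Fin n) : PAlg k μ n :=
  -(asP k μ n i * aP k μ n j) + (if i = j then 1 - μ else 0) • e0P k μ n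

theorem extA_self (i : Fin n) : extA μ n i i = algebraMap k (PAlg k μ n) (1 - μ) := by
  rw [extA, asP_mul_aP_self, if_pos rfl, Algebra.algebraMap_eq_smul_one, ← e0P_add_e1P,
    smul_add, PAlg.neg_smul, neg_sub, add_comm]

theorem extA_of_ne {i j : Fin n} (h : i ≠ j) :
    extA μ n i j = -(asP k μ n i * aP k μ n j) := by
  rw [extA, if_neg h, zero_smul, add_zero]

theorem extA_mul_e1P (i j : Fin n) :
    extA μ n i j * e1P k μ n = -(asP k μ n i * aP k μ n j) := by
  rw [extA, add_mul, smul_mul_assoc, e0P_mul_e1P, smul_zero, add_zero, PAlg.neg_mul, mul_assoc,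
    aP_mul_e1P]

theorem e1P_mul_extA (i j : Fin n) :
    e1P k μ n * extA μ n i j = -(asP k μ n i * aP k μ n j) := by
  rw [extA, mul_add, mul_smul_comm, e1P_mul_e0P, smul_zero, add_zero, PAlg.mul_neg, ← mul_assoc,
    e1P_mul_asP]

/-- An algebra generated by elements `A i j` with `A i i = 1 - μ`, such that `A i j ↦ extA i j`
extends to a homomorphism, is isomorphic to the corner `e₁ A^{(n)} e₁` via `A i j ↦ -a_i^* a_j`. -/
theorem exists_corner_hom (A : Fin n → Fin n → B)
    (hA : ∀ i, A i i = algebraMap k B (1 - μ))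
    (hgen : Algebra.adjoin k (Set.range fun p : Fin n × Fin n => A p.1 p.2) = ⊤)
    (f : B →ₐ[k] PAlg k μ n) (hf : ∀ i j, f (A i j) = extA μ n i j) :
    ∃ φ : B →ₙₐ[k] PAlg k μ n, (∀ b, φ b = f b * e1P k μ n) ∧ Function.Injective φ ∧
      Set.range φ = {z : PAlg k μ n | e1P k μ n * z * e1P k μ n = z} := by
  have hcomm (b : B) : e1P k μ n * f b = f b * e1P k μ n := by
    have hb : b ∈ Algebra.adjoin k (Set.range fun p : Fin n × Fin n => A p.1 p.2) :=
      hgen ▸ Algebra.mem_top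
    induction hb using Algebra.adjoin_induction with
    | mem x hx =>
      obtain ⟨p, rfl⟩ := hx
      simp only [hf, extA_mul_e1P, e1P_mul_extA]
    | algebraMap r => simpa only [AlgHom.commutes] using (Algebra.commutes r _).symm
    | add x y _ _ hx hy => rw [map_add, mul_add, add_mul, hx, hy]
    | mul x y _ _ hx hy => rw [map_mul, ← mul_assoc, hx, mul_assoc, hy, mul_assoc]
  have hcorner (b : B) : e1P k μ n * (f b * e1P k μ n) = f b * e1P k μ n := by
    rw [← mul_assoc, hcomm, mul_assoc, e1P_mul_e1P]
  let φ : B →ₙₐ[k] PAlg k μ n :=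
    { toFun := fun b => f b * e1P k μ n
      map_smul' := fun r b => by simp
      map_zero' := by simp
      map_add' := fun x y => by rw [map_add, add_mul]
      map_mul' := fun x y => by rw [map_mul, mul_assoc, mul_assoc, hcorner] }
  have hφ (b : B) : φ b = f b * e1P k μ n := rfl
  refine ⟨φ, hφ, ?_, ?_⟩
  · have hrep (b : B) : cornerRep A hA (φ b) =
        Matrix.fromBlocks (Matrix.of fun _ _ => b) 0 0 0 := by
      have hb : b ∈ Algebra.adjoin k (Set.range fun p : Fin n × Fin n => A p.1 p.2) :=
        hgen ▸ Algebra.mem_top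
      induction hb using Algebra.adjoin_induction with
      | mem x hx =>
        obtain ⟨p, rfl⟩ := hx
        rw [hφ, hf, extA_mul_e1P, map_neg, cornerRep_asP_mul_aP, Matrix.fromBlocks_neg]
        congr 1 <;> ext <;> simp
      | algebraMap r =>
        rw [hφ, AlgHom.commutes, ← Algebra.smul_def, map_smul, cornerRep_e1P,
          Matrix.fromBlocks_smul]
        congr 1 <;> ext <;> simp [Algebra.smul_def]
      | add x y _ _ hx hy =>
        rw [map_add, map_add, hx, hy, Matrix.fromBlocks_add]
        congr 1 <;> ext <;> simp
      | mul x y _ _ hx hy =>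
        rw [map_mul, map_mul, hx, hy, Matrix.fromBlocks_multiply]
        congr 1 <;> ext <;> simp [Matrix.mul_apply]
    intro b c h
    have := congrArg (fun M => M (Sum.inl ()) (Sum.inl ()))
      ((hrep b).symm.trans ((congrArg _ h).trans (hrep c)))
    simpa using this
  · refine Set.Subset.antisymm ?_ fun z hz => ?_
    · rintro _ ⟨b, rfl⟩
      change e1P k μ n * (f b * e1P k μ n) * e1P k μ n = f b * e1P k μ n
      rw [hcorner, mul_assoc, e1P_mul_e1P]
    · let N : Submodule k (PAlg k μ n) :=
        Submodule.span k (Set.range φ ∪ {z | ∃ j b, z = aP k μ n j * φ b})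
      let S : Subalgebra k (PAlg k μ n) :=
        { carrier := {x | ∀ y ∈ N, x * y ∈ N}
          mul_mem' := fun {x x'} hx hx' y hy => by
            rw [mul_assoc]; exact hx _ (hx' _ hy)
          add_mem' := fun {x x'} hx hx' y hy => by
            rw [add_mul]; exact N.add_mem (hx _ hy) (hx' _ hy)
          algebraMap_mem' := fun r y hy => by
            rw [← Algebra.smul_def]; exact N.smul_mem _ hy }
      have hNφ (b : B) : φ b ∈ N := Submodule.subset_span (Or.inl ⟨b, rfl⟩)
      have hNa (j : Fin n) (b : B) : aP k μ n j * φ b ∈ N :=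
        Submodule.subset_span (Or.inr ⟨j, b, rfl⟩)
      have he1 (b : B) : e1P k μ n * φ b = φ b := hcorner b
      have hmem (x : PAlg k μ n) (h1 : ∀ b, x * φ b ∈ N)
          (h2 : ∀ j b, x * aP k μ n j * φ b ∈ N) : x ∈ S := by
        intro y hy
        induction hy using Submodule.span_induction with
        | mem y hy =>
          obtain ⟨b, rfl⟩ | ⟨j, b, rfl⟩ := hy
          · exact h1 b
          · rw [← mul_assoc]; exact h2 j b
        | zero => rw [mul_zero]; exact N.zero_mem
        | add y y' _ _ hy hy' => rw [mul_add]; exact N.add_mem hy hy'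
        | smul r y _ hy => rw [mul_smul_comm]; exact N.smul_mem r hy
      have hS : S = ⊤ := by
        refine PAlg.subalgebra_eq_top S (hmem _ (fun b => ?_) fun j b => ?_)
          (hmem _ (fun b => ?_) fun j b => ?_) (fun i => hmem _ (hNa i) fun j b => ?_)
          fun i => hmem _ (fun b => ?_) fun j b => ?_
        · rw [← he1, ← mul_assoc, e0P_mul_e1P, zero_mul]; exact N.zero_mem
        · rw [e0P_mul_aP]; exact hNa j b
        · rw [he1]; exact hNφ b
        · rw [e1P_mul_aP, zero_mul]; exact N.zero_mem
        · rw [aP_mul_aP, zero_mul]; exact N.zero_mem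
        · rw [← he1, ← mul_assoc, asP_mul_e1P, zero_mul]; exact N.zero_mem
        · have : asP k μ n i * aP k μ n j = φ (-A i j) := by
            rw [map_neg, hφ, hf, extA_mul_e1P, neg_neg]
          rw [this, ← map_mul]
          exact hNφ _
      have hN (y : PAlg k μ n) (hy : y ∈ N) : e1P k μ n * y ∈ Set.range φ := by
        induction hy using Submodule.span_induction with
        | mem y hy =>
          obtain ⟨b, rfl⟩ | ⟨j, b, rfl⟩ := hy
          · exact ⟨b, (he1 b).symm⟩
          · exact ⟨0, by rw [map_zero, ← mul_assoc, e1P_mul_aP, zero_mul]⟩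
        | zero => exact ⟨0, by rw [map_zero, mul_zero]⟩
        | add y y' _ _ hy hy' =>
          obtain ⟨b, hb⟩ := hy
          obtain ⟨c, hc⟩ := hy'
          exact ⟨b + c, by rw [map_add, mul_add, hb, hc]⟩
        | smul r y _ hy =>
          obtain ⟨b, hb⟩ := hy
          exact ⟨r • b, by rw [map_smul, mul_smul_comm, hb]⟩
      have hzS : z ∈ S := hS ▸ Algebra.mem_top
      have hz1 : z * e1P k μ n ∈ N := by
        refine hzS _ ?_
        have := hNφ 1
        rwa [hφ, map_one, one_mul] at this
      have := hN _ hz1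
      rwa [← mul_assoc, show e1P k μ n * z * e1P k μ n = z from hz] at this

end Corner

section Presentations

variable {k} {n : ℕ}

theorem AQuot.adjoin_eq_top (μ : k) : Algebra.adjoin k (Set.range fun p : Fin n × Fin n =>
    RingQuot.mkAlgHom k (ARel k μ n) (FreeAlgebra.ι k (p.1, p.2))) = ⊤ := by
  have h := congrArg (Subalgebra.map (RingQuot.mkAlgHom k (ARel k μ n)))
    (FreeAlgebra.adjoin_range_ι k (Fin n × Fin n))
  rw [AlgHom.map_adjoin, ← Set.range_comp, Algebra.map_top,
    (AlgHom.range_eq_top _).2 (RingQuot.mkAlgHom_surjective k _)] at h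
  exact h

/-- The elements `A_{ij}` of the free algebra on the `a_{ij}` (`i ≠ j`): `A_{ij} = a_{ij}` for
`i < j`, `A_{ij} = -μ a_{ij}` for `i > j` and `A_{ii} = 1 - μ`. -/
noncomputable def freeA (μ : k) (i j : Fin n) :
    FreeAlgebra k {p : Fin n × Fin n // p.1 ≠ p.2} :=
  if h : i ≠ j then
    (if i < j then (1 : k) else -μ) • FreeAlgebra.ι k ⟨(i, j), h⟩
  else algebraMap k _ (1 - μ)

theorem adjoin_freeA_eq_top (μ : kˣ) : Algebra.adjoin k (Set.range fun p : Fin n × Fin n =>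
    freeA (μ : k) p.1 p.2) = ⊤ := by
  rw [eq_top_iff, ← FreeAlgebra.adjoin_range_ι, Algebra.adjoin_le_iff]
  rintro _ ⟨⟨⟨i, j⟩, h⟩, rfl⟩
  have hmem : freeA (μ : k) i j ∈ Algebra.adjoin k (Set.range fun p : Fin n × Fin n =>
      freeA (μ : k) p.1 p.2) := Algebra.subset_adjoin ⟨(i, j), rfl⟩
  have := Subalgebra.smul_mem _ hmem (if i < j then (1 : k) else -((μ⁻¹ : kˣ) : k))
  rw [freeA, dif_pos h, smul_smul] at this
  split_ifs at this <;> simpa using this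

/-- The images of the `a_{ij}` in `A^{(n)}`. -/
noncomputable def freeGen (μ : kˣ) (n : ℕ) (p : {p : Fin n × Fin n // p.1 ≠ p.2}) :
    PAlg k (μ : k) n :=
  if p.1.1 < p.1.2 then -(asP k (μ : k) n p.1.1 * aP k (μ : k) n p.1.2)
  else ((μ⁻¹ : kˣ) : k) • (asP k (μ : k) n p.1.1 * aP k (μ : k) n p.1.2)

theorem freeGen_mul_e1P (μ : kˣ) (p : {p : Fin n × Fin n // p.1 ≠ p.2}) :
    freeGen μ n p * e1P k (μ : k) n = freeGen μ n p := by
  unfold freeGen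
  split_ifs
  · rw [PAlg.neg_mul, mul_assoc, aP_mul_e1P]
  · rw [smul_mul_assoc, mul_assoc, aP_mul_e1P]

theorem lift_freeGen_freeA (μ : kˣ) (i j : Fin n) :
    FreeAlgebra.lift k (freeGen μ n) (freeA (μ : k) i j) = extA (μ : k) n i j := by
  by_cases h : i = j
  · subst h
    rw [freeA, dif_neg (not_not.2 rfl), AlgHom.commutes, extA_self]
  · rw [freeA, dif_pos h, map_smul, FreeAlgebra.lift_ι_apply, extA_of_ne h, freeGen]
    split_ifs
    · rw [one_smul]
    · rw [smul_smul, neg_mul, Units.mul_inv, neg_smul, one_smul]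

end Presentations

theorem statement8 (μ : kˣ) (n : ℕ) :
    -- A^{(n)}(1,1) ≅ k⟨A_{ij}⟩/(A_{ii} = (1−μ)·1): there is an injective
    -- k-linear multiplicative map sending 1 to e₁ and A_{ij} to −a_i^* a_j whose
    -- range is exactly the corner e₁·A^{(n)}·e₁ = A^{(n)}(1,1)
    (∃ φ : AQuot k (μ : k) n →ₙₐ[k] PAlg k (μ : k) n,
      φ 1 = e1P k (μ : k) n ∧
      (∀ i j : Fin n,
        φ (RingQuot.mkAlgHom k (ARel k (μ : k) n) (FreeAlgebra.ι k (i, j))) =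
          -(asP k (μ : k) n i * aP k (μ : k) n j)) ∧
      Function.Injective φ ∧
      Set.range φ = {z : PAlg k (μ : k) n |
        e1P k (μ : k) n * z * e1P k (μ : k) n = z}) ∧
    -- equivalently, A^{(n)}(1,1) is free associative on the a_{ij} (i ≠ j), where
    -- a_{ij} = A_{ij} = −a_i^* a_j for i < j and a_{ij} = −μ⁻¹A_{ij} = μ⁻¹a_i^* a_j
    -- for i > j
    (∃ ψ : FreeAlgebra k {p : Fin n × Fin n // p.1 ≠ p.2} →ₙₐ[k] PAlg k (μ : k) n,
      ψ 1 = e1P k (μ : k) n ∧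
      (∀ p : {p : Fin n × Fin n // p.1 ≠ p.2},
        ψ (FreeAlgebra.ι k p) =
          if p.1.1 < p.1.2 then -(asP k (μ : k) n p.1.1 * aP k (μ : k) n p.1.2)
          else ((μ⁻¹ : kˣ) : k) • (asP k (μ : k) n p.1.1 * aP k (μ : k) n p.1.2)) ∧
      Function.Injective ψ ∧
      Set.range ψ = {z : PAlg k (μ : k) n |
        e1P k (μ : k) n * z * e1P k (μ : k) n = z}) := by
  constructor
  · let f : AQuot k (μ : k) n →ₐ[k] PAlg k (μ : k) n :=
      RingQuot.liftAlgHom k ⟨FreeAlgebra.lift k fun p => extA (μ : k) n p.1 p.2, by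
        rintro _ _ ⟨i⟩
        rw [FreeAlgebra.lift_ι_apply, AlgHom.commutes, extA_self]⟩
    have hf (i j : Fin n) : f (RingQuot.mkAlgHom k (ARel k (μ : k) n)
        (FreeAlgebra.ι k (i, j))) = extA (μ : k) n i j := by
      simp [f]
    obtain ⟨φ, hφ, hinj, hrange⟩ := exists_corner_hom
      (fun i j => RingQuot.mkAlgHom k (ARel k (μ : k) n) (FreeAlgebra.ι k (i, j)))
      (fun i => by rw [RingQuot.mkAlgHom_rel k (ARel.diag i), AlgHom.commutes])
      (AQuot.adjoin_eq_top (μ : k)) f hf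
    exact ⟨φ, by rw [hφ, map_one, one_mul], fun i j => by rw [hφ, hf, extA_mul_e1P],
      hinj, hrange⟩
  · obtain ⟨ψ, hψ, hinj, hrange⟩ := exists_corner_hom (freeA (n := n) (μ : k))
      (fun i => by rw [freeA, dif_neg (not_not.2 rfl)]) (adjoin_freeA_eq_top μ)
      (FreeAlgebra.lift k (freeGen μ n)) (lift_freeGen_freeA μ)
    refine ⟨ψ, by rw [hψ, map_one, one_mul], fun p => ?_, hinj, hrange⟩
    rw [hψ, FreeAlgebra.lift_ι_apply, freeGen_mul_e1P, freeGen]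
end
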